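/- arXiv:0908.1072 — 3 statements merged into one kernel-verified Lean document; each statement's English description precedes it below -/
import Mathlib

section
/- Let (ξᵢ)_{i∈ℕ} be independent identically distributed square-integrable real random variables with E[ξ₁] = a and Var(ξ₁) = σ², let π be a Poisson process of intensity 1 independent of the sequence (ξᵢ), and assume (s, ω) ↦ π(s, ω) is jointly measurable. Assume f : [1,∞) → (0,∞) satisfies condition (B): for some β > 0 the function x ↦ f(x)/x^β is increasing. Then for almost every ω ∈ Ω, for every bounded continuous function g : ℝ → ℝ, one has (1/log S) ∫_1^S g((∑_{i=1}^{π(f(s),ω)} ξᵢ(ω) − a·f(s))/√f(s))·(1/s) ds → ∫ g dN(0, σ² + a²) as S → ∞. (One-dimensional marginal form of Corollary 3.) -/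
open MeasureTheory ProbabilityTheory Filter Topology NNReal

lemma aux_tendsto_approx {ι : Type*} {l : Filter ι} (v : ι → ℝ) (v0 : ℝ)
    (h : ∀ ε > 0, ∃ (u : ι → ℝ) (c : ℝ), Tendsto u l (𝓝 c) ∧ (∀ᶠ i in l, |v i - u i| ≤ ε) ∧
      |v0 - c| ≤ ε) : Tendsto v l (𝓝 v0) := by
  rw [Metric.tendsto_nhds]
  intro ε hε
  obtain ⟨u, c, hu, h1, h2⟩ := h (ε/4) (by positivity)
  have h3 := (Metric.tendsto_nhds.1 hu) (ε/4) (by positivity)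
  filter_upwards [h1, h3] with i hi1 hi3
  rw [Real.dist_eq] at *
  rw [abs_le] at hi1 h2
  rw [abs_lt] at *
  constructor <;> linarith [hi1.1, hi1.2, h2.1, h2.2, hi3.1, hi3.2]

noncomputable def auxBump (K : ℕ) : ContDiffBump (0 : ℝ) :=
  ⟨(K : ℝ) + 1, (K : ℝ) + 2, by positivity, by linarith⟩

noncomputable def auxH (K n : ℕ) (x : ℝ) : ℝ := auxBump K x * x ^ n

lemma auxH_contDiff (K n : ℕ) : ContDiff ℝ 1 (auxH K n) := by
  unfold auxH
  exact (auxBump K).contDiff.mul (contDiff_id.pow n)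

lemma auxH_supp (K n : ℕ) : HasCompactSupport (auxH K n) := by
  unfold auxH
  exact (auxBump K).hasCompactSupport.mul_right

lemma auxH_lip (K n : ℕ) : ∃ C, LipschitzWith C (auxH K n) :=
  ContDiff.lipschitzWith_of_hasCompactSupport (auxH_supp K n) (auxH_contDiff K n) (by simp)

lemma auxH_bdd (K n : ℕ) : ∃ C, ∀ x, |auxH K n x| ≤ C :=
  (auxH_supp K n).exists_bound_of_continuous (auxH_contDiff K n).continuous

lemma aux_bdd_integrable {μ : Measure ℝ} [IsProbabilityMeasure μ] {g : ℝ → ℝ} (hg : Continuous g)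
    {B : ℝ} (hB : ∀ x, |g x| ≤ B) : Integrable g μ :=
  Integrable.of_bound hg.aestronglyMeasurable B (ae_of_all _ hB)

lemma aux_int_diff {μ : Measure ℝ} [IsProbabilityMeasure μ] {g k : ℝ → ℝ} (hg : Integrable g μ)
    (hk : Integrable k μ) {ε : ℝ} (h : ∀ x, |g x - k x| ≤ ε) : |∫ x, g x ∂μ - ∫ x, k x ∂μ| ≤ ε := by
  rw [← integral_sub hg hk]
  have := norm_integral_le_of_norm_le_const (μ := μ) (f := fun x => g x - k x) (C := ε)
    (ae_of_all _ h)
  simpa using this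

lemma aux_weak {ι : Type*} {l : Filter ι} (ν : ι → Measure ℝ) [∀ i, IsProbabilityMeasure (ν i)]
    (ν0 : Measure ℝ) [IsProbabilityMeasure ν0]
    (h : ∀ K n, Tendsto (fun i => ∫ x, auxH K n x ∂(ν i)) l (𝓝 (∫ x, auxH K n x ∂ν0)))
    (g : BoundedContinuousFunction ℝ ℝ) :
    Tendsto (fun i => ∫ x, g x ∂(ν i)) l (𝓝 (∫ x, g x ∂ν0)) := by
  have hint : ∀ (μ : Measure ℝ) [IsProbabilityMeasure μ] K n, Integrable (auxH K n) μ := by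
    intro μ _ K n
    obtain ⟨C, hC⟩ := auxH_bdd K n
    exact aux_bdd_integrable (auxH_contDiff K n).continuous hC
  have hgb : ∀ x, |g x| ≤ ‖g‖ := fun x => g.norm_coe_le_norm x
  have hchi1 : ∀ K x, auxBump K x ≤ 1 := fun K x => (auxBump K).le_one
  have hchi0 : ∀ K x, 0 ≤ auxBump K x := fun K x => (auxBump K).nonneg
  have hchic : ∀ K, Continuous (auxBump K) := fun K => (auxBump K).continuous
  have hcgint : ∀ (μ : Measure ℝ) [IsProbabilityMeasure μ] K,
      Integrable (fun x => auxBump K x * g x) μ := by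
    intro μ _ K
    refine aux_bdd_integrable ((hchic K).mul g.continuous) (B := ‖g‖) fun x => ?_
    rw [abs_mul, abs_of_nonneg (hchi0 K x)]
    have := mul_le_mul (hchi1 K x) (hgb x) (abs_nonneg _) zero_le_one
    simpa using this
  have hcint : ∀ (μ : Measure ℝ) [IsProbabilityMeasure μ] K,
      Integrable (fun x => auxBump K x) μ := by
    intro μ _ K
    refine (hint μ K 0).congr (ae_of_all _ fun x => ?_)
    simp [auxH]
  -- polynomials
  have hpint : ∀ (μ : Measure ℝ) [IsProbabilityMeasure μ] K (p : Polynomial ℝ),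
      ∫ x, auxBump K x * p.eval x ∂μ = ∑ n ∈ Finset.range (p.natDegree + 1),
        p.coeff n * ∫ x, auxH K n x ∂μ := by
    intro μ _ K p
    simp_rw [← integral_const_mul]
    rw [← integral_finsetSum _ (fun n _ => (hint μ K n).const_mul _)]
    congr 1
    ext x
    rw [Polynomial.eval_eq_sum_range, Finset.mul_sum]
    refine Finset.sum_congr rfl fun n _ => ?_
    simp only [auxH]; ring
  have hpoly : ∀ K (p : Polynomial ℝ), Tendsto (fun i => ∫ x, auxBump K x * p.eval x ∂(ν i)) l
      (𝓝 (∫ x, auxBump K x * p.eval x ∂ν0)) := by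
    intro K p
    simp_rw [hpint]
    exact tendsto_finsetSum _ fun n _ => (h K n).const_mul _
  have hpintg : ∀ (μ : Measure ℝ) [IsProbabilityMeasure μ] K (p : Polynomial ℝ),
      Integrable (fun x => auxBump K x * p.eval x) μ := by
    intro μ _ K p
    obtain ⟨C, hC⟩ := ((auxBump K).hasCompactSupport.mul_right (f' := fun x => p.eval x)).exists_bound_of_continuous
      ((hchic K).mul p.continuous)
    exact aux_bdd_integrable ((hchic K).mul p.continuous) hC
  have hcg : ∀ K, Tendsto (fun i => ∫ x, auxBump K x * g x ∂(ν i)) l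
      (𝓝 (∫ x, auxBump K x * g x ∂ν0)) := by
    intro K
    refine aux_tendsto_approx _ _ fun ε hε => ?_
    obtain ⟨p, hp⟩ := exists_polynomial_near_of_continuousOn (-((K : ℝ)+2)) ((K : ℝ)+2) g
      g.continuous.continuousOn ε hε
    have key : ∀ x, |auxBump K x * g x - auxBump K x * p.eval x| ≤ ε := by
      intro x
      rw [← mul_sub, abs_mul, abs_of_nonneg (hchi0 K x)]
      by_cases hx : x ∈ Set.Icc (-((K : ℝ)+2)) ((K : ℝ)+2)
      · have h1 := hp x hx
        rw [abs_sub_comm] at h1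
        have := mul_le_mul (hchi1 K x) h1.le (abs_nonneg _) zero_le_one
        simpa using this
      · have : auxBump K x = 0 := by
          apply (auxBump K).zero_of_le_dist
          simp only [Set.mem_Icc, not_and_or, not_le] at hx
          change (K : ℝ) + 2 ≤ _
          rw [Real.dist_eq, sub_zero]
          rcases hx with hx | hx
          · linarith [neg_le_abs x]
          · linarith [le_abs_self x]
        rw [this]; simpa using hε.le
    exact ⟨_, _, hpoly K p, Eventually.of_forall fun i => aux_int_diff (hcgint _ K) (hpintg _ K p) key,
      aux_int_diff (hcgint _ K) (hpintg _ K p) key⟩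
  -- tightness
  have htight : Tendsto (fun K : ℕ => ∫ x, auxBump K x ∂ν0) atTop (𝓝 1) := by
    have : Tendsto (fun K : ℕ => ∫ x, auxBump K x ∂ν0) atTop (𝓝 (∫ x, (1:ℝ) ∂ν0)) := by
      refine tendsto_integral_of_dominated_convergence (fun _ => 1)
        (fun K => (hchic K).aestronglyMeasurable) (integrable_const _) ?_ ?_
      · intro K
        refine ae_of_all _ fun x => ?_
        rw [Real.norm_eq_abs, abs_of_nonneg (hchi0 K x)]; exact hchi1 K x
      · refine ae_of_all _ fun x => ?_
        refine tendsto_const_nhds.congr' ?_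
        filter_upwards [eventually_ge_atTop ⌈|x|⌉₊] with K hK
        symm
        apply (auxBump K).one_of_mem_closedBall
        rw [Metric.mem_closedBall, Real.dist_eq, sub_zero]
        change _ ≤ (K : ℝ) + 1
        have : |x| ≤ K := Nat.ceil_le.1 hK
        linarith
    simpa using this
  have hdiff : ∀ (μ : Measure ℝ) [IsProbabilityMeasure μ] K,
      |∫ x, g x ∂μ - ∫ x, auxBump K x * g x ∂μ| ≤ ‖g‖ * (1 - ∫ x, auxBump K x ∂μ) := by
    intro μ _ K
    have e : ‖g‖ * (1 - ∫ x, auxBump K x ∂μ) = ∫ x, ‖g‖ * (1 - auxBump K x) ∂μ := by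
      rw [integral_const_mul, integral_sub (integrable_const _) (hcint μ K)]; simp
    rw [e, ← integral_sub (aux_bdd_integrable g.continuous hgb) (hcgint μ K)]
    refine norm_integral_le_of_norm_le (f := fun x => g x - auxBump K x * g x) (g := fun x => ‖g‖ * (1 - auxBump K x))
      (((integrable_const (1:ℝ)).sub (hcint μ K)).const_mul _)
      (ae_of_all _ fun x => ?_)
    rw [Real.norm_eq_abs, show g x - auxBump K x * g x = g x * (1 - auxBump K x) by ring, abs_mul,
      abs_of_nonneg (by linarith [hchi1 K x] : 0 ≤ 1 - auxBump K x)]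
    exact mul_le_mul_of_nonneg_right (hgb x) (by linarith [hchi1 K x])
  refine aux_tendsto_approx _ _ fun ε hε => ?_
  have ht2 : Tendsto (fun K : ℕ => ‖g‖ * (1 - ∫ x, auxBump K x ∂ν0)) atTop (𝓝 0) := by
    simpa using (htight.const_sub 1).const_mul ‖g‖
  obtain ⟨K, hK⟩ := ((tendsto_order.1 ht2).2 ε hε).exists
  have h0 : Tendsto (fun i => ‖g‖ * (1 - ∫ x, auxBump K x ∂(ν i))) l
      (𝓝 (‖g‖ * (1 - ∫ x, auxBump K x ∂ν0))) := by
    have := h K 0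
    simp only [auxH, pow_zero, mul_one] at this
    exact (this.const_sub 1).const_mul _
  refine ⟨_, _, hcg K, ?_, (hdiff ν0 K).trans hK.le⟩
  filter_upwards [(tendsto_order.1 h0).2 ε hK] with i hi
  exact (hdiff _ K).trans hi.le

lemma aux_exp_int (γ : ℝ) (hγ : 0 < γ) : Integrable (fun y : ℝ => Real.exp (-γ * |y|)) := by
  rw [← integrableOn_univ, ← Set.Iic_union_Ioi (a := (0:ℝ))]
  refine IntegrableOn.union ?_ ?_
  · refine (integrableOn_exp_mul_Iic hγ 0).congr_fun (fun x hx => ?_) measurableSet_Iic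
    simp only [Set.mem_Iic] at hx
    simp only [abs_of_nonpos hx]; ring_nf
  · refine (integrableOn_exp_mul_Ioi (neg_lt_zero.2 hγ) 0).congr_fun (fun x hx => ?_) measurableSet_Ioi
    simp only [Set.mem_Ioi] at hx
    simp only [abs_of_pos hx]

lemma aux_second_moment {Ω : Type*} [MeasurableSpace Ω] (P : Measure Ω) [IsProbabilityMeasure P]
    (Y : ℝ → Ω → ℝ) (hY : Measurable (Function.uncurry Y)) (B : ℝ) (hB : ∀ x ω, |Y x ω| ≤ B)
    (C γ : ℝ) (hC0 : 0 ≤ C) (hγ : 0 < γ)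
    (hC : ∀ x y, 0 ≤ x → x ≤ y → |∫ ω, Y x ω * Y y ω ∂P| ≤ C * Real.exp (-γ * (y - x)))
    (T : ℝ) (hT : 0 ≤ T) :
    ∫ ω, (∫ x in Set.Ioc 0 T, Y x ω) ^ 2 ∂P ≤ C * (∫ y : ℝ, Real.exp (-γ * |y|)) * T := by
  set m : Measure ℝ := volume.restrict (Set.Ioc 0 T) with hm
  have : IsFiniteMeasure m := by rw [hm]; infer_instance
  have e1 : ∀ ω, (∫ x, Y x ω ∂m) ^ 2 = ∫ z, Y z.1 ω * Y z.2 ω ∂(m.prod m) := by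
    intro ω
    rw [sq, ← integral_prod_mul (μ := m) (ν := m) (fun x => Y x ω) (fun x => Y x ω)]
  simp_rw [e1]
  have hYm1 : Measurable (fun q : Ω × (ℝ × ℝ) => Y q.2.1 q.1) :=
    hY.comp ((measurable_fst.comp measurable_snd).prodMk measurable_fst)
  have hYm2 : Measurable (fun q : Ω × (ℝ × ℝ) => Y q.2.2 q.1) :=
    hY.comp ((measurable_snd.comp measurable_snd).prodMk measurable_fst)
  have hint : Integrable (Function.uncurry fun (ω : Ω) (z : ℝ × ℝ) => Y z.1 ω * Y z.2 ω)
      (P.prod (m.prod m)) := by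
    refine Integrable.of_bound (hYm1.mul hYm2).aestronglyMeasurable (B * B) (ae_of_all _ fun q => ?_)
    simp only [Function.uncurry, Real.norm_eq_abs, abs_mul]
    exact mul_le_mul (hB _ _) (hB _ _) (abs_nonneg _) ((abs_nonneg _).trans (hB q.2.1 q.1))
  rw [integral_integral_swap hint]
  have hexpc : Continuous (fun z : ℝ × ℝ => C * Real.exp (-γ * |z.2 - z.1|)) := by fun_prop
  have hint2 : Integrable (fun z : ℝ × ℝ => C * Real.exp (-γ * |z.2 - z.1|)) (m.prod m) := by
    refine Integrable.of_bound hexpc.aestronglyMeasurable C (ae_of_all _ fun z => ?_)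
    rw [Real.norm_eq_abs, abs_mul, abs_of_nonneg hC0, Real.abs_exp]
    refine mul_le_of_le_one_right hC0 (Real.exp_le_one_iff.2 ?_)
    have := mul_nonneg hγ.le (abs_nonneg (z.2 - z.1))
    linarith
  have hmem : ∀ᵐ z ∂(m.prod m), 0 ≤ z.1 ∧ 0 ≤ z.2 := by
    rw [hm, Measure.prod_restrict]
    filter_upwards [ae_restrict_mem (measurableSet_Ioc.prod measurableSet_Ioc)] with z hz
    exact ⟨hz.1.1.le, hz.2.1.le⟩
  calc ∫ z, ∫ ω, Y z.1 ω * Y z.2 ω ∂P ∂(m.prod m)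
      ≤ ∫ z, C * Real.exp (-γ * |z.2 - z.1|) ∂(m.prod m) := by
        refine integral_mono_ae hint.swap.integral_prod_left hint2 ?_
        filter_upwards [hmem] with z hz
        refine (le_abs_self _).trans ?_
        rcases le_total z.1 z.2 with h | h
        · rw [abs_of_nonneg (sub_nonneg.2 h)]
          exact hC _ _ hz.1 h
        · rw [abs_of_nonpos (sub_nonpos.2 h), neg_sub]
          simp_rw [mul_comm (Y z.1 _)]
          exact hC _ _ hz.2 h
    _ = ∫ x, ∫ y, C * Real.exp (-γ * |y - x|) ∂m ∂m := integral_prod _ hint2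
    _ ≤ ∫ x, C * (∫ y : ℝ, Real.exp (-γ * |y|)) ∂m := by
        refine integral_mono hint2.integral_prod_left (integrable_const _) fun x => ?_
        simp only
        rw [integral_const_mul]
        refine mul_le_mul_of_nonneg_left ?_ hC0
        rw [← integral_sub_right_eq_self (fun y => Real.exp (-γ * |y|)) x]
        refine setIntegral_le_integral ((aux_exp_int γ hγ).comp_sub_right x) (ae_of_all _ fun y => ?_)
        exact (Real.exp_pos _).le
    _ = C * (∫ y : ℝ, Real.exp (-γ * |y|)) * T := by
        simp [hm, hT, mul_comm]

lemma aux_ergodic {Ω : Type*} [MeasurableSpace Ω] (P : Measure Ω) [IsProbabilityMeasure P]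
    (Y : ℝ → Ω → ℝ) (hY : Measurable (Function.uncurry Y)) (B : ℝ) (hB : ∀ x ω, |Y x ω| ≤ B)
    (C γ : ℝ) (hC0 : 0 ≤ C) (hγ : 0 < γ)
    (hC : ∀ x y, 0 ≤ x → x ≤ y → |∫ ω, Y x ω * Y y ω ∂P| ≤ C * Real.exp (-γ * (y - x))) :
    ∀ᵐ ω ∂P, Tendsto (fun T : ℝ => (1 / T) * ∫ x in Set.Ioc 0 T, Y x ω) atTop (𝓝 0) := by
  set D := C * (∫ y : ℝ, Real.exp (-γ * |y|)) with hD
  have hD0 : 0 ≤ D := mul_nonneg hC0 (integral_nonneg fun y => (Real.exp_pos _).le)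
  have hΩ : Nonempty Ω := nonempty_of_isProbabilityMeasure P
  have hB0 : 0 ≤ B := (abs_nonneg _).trans (hB 0 hΩ.some)
  set I : ℝ → Ω → ℝ := fun T ω => ∫ x in Set.Ioc 0 T, Y x ω with hI
  have hIm : ∀ T, Measurable (I T) := fun T =>
    (StronglyMeasurable.integral_prod_left (μ := volume.restrict (Set.Ioc 0 T))
      hY.stronglyMeasurable).measurable
  have hYi : ∀ ω a b, IntegrableOn (fun x => Y x ω) (Set.Ioc a b) := by
    intro ω a b
    exact Integrable.of_bound (hY.comp (measurable_id.prodMk measurable_const)).aestronglyMeasurable B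
      (ae_of_all _ fun x => hB x ω)
  have hIb : ∀ ω a b, 0 ≤ a → a ≤ b → |I b ω - I a ω| ≤ B * (b - a) := by
    intro ω a b ha hab
    have : I b ω - I a ω = ∫ x in Set.Ioc a b, Y x ω := by
      simp only [hI]
      rw [← Set.Ioc_union_Ioc_eq_Ioc ha hab, setIntegral_union (Set.Ioc_disjoint_Ioc_of_le le_rfl)
        measurableSet_Ioc (hYi ω _ _) (hYi ω _ _)]
      ring
    rw [this]
    have := norm_setIntegral_le_of_norm_le_const (μ := volume) (s := Set.Ioc a b)
      (f := fun x => Y x ω) (C := B) (by simp) (fun x _ => hB x ω)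
    simpa [hab] using this
  have hI0 : ∀ ω, I 0 ω = 0 := by intro ω; simp [hI]
  -- along squares
  have hsq : ∀ᵐ ω ∂P, Tendsto (fun k : ℕ => (1 / ((k:ℝ)+1) ^ 2) * I (((k:ℝ)+1) ^ 2) ω) atTop (𝓝 0) := by
    set G : ℕ → Ω → ℝ := fun k ω => ((1 / ((k:ℝ)+1) ^ 2) * I (((k:ℝ)+1) ^ 2) ω) ^ 2 with hG
    have hGm : ∀ k, Measurable (G k) := fun k => ((hIm _).const_mul _).pow_const 2
    have hG0 : ∀ k ω, 0 ≤ G k ω := fun k ω => sq_nonneg _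
    have hGi : ∀ k, Integrable (G k) P := by
      intro k
      refine Integrable.of_bound (hGm k).aestronglyMeasurable (B ^ 2) (ae_of_all _ fun ω => ?_)
      rw [Real.norm_eq_abs, abs_of_nonneg (hG0 k ω), hG]
      simp only
      rw [sq_le_sq, abs_mul, abs_of_nonneg hB0]
      have := hIb ω 0 (((k:ℝ)+1) ^ 2) le_rfl (by positivity)
      rw [hI0, sub_zero, sub_zero] at this
      rw [abs_of_pos (by positivity), one_div, inv_mul_le_iff₀ (by positivity)]
      linarith
    have hGE : ∀ k, ∫ ω, G k ω ∂P ≤ D * (1 / ((k:ℝ)+1) ^ 2) := by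
      intro k
      have := aux_second_moment P Y hY B hB C γ hC0 hγ hC (((k:ℝ)+1) ^ 2) (by positivity)
      simp only [hG, mul_pow]
      rw [integral_const_mul]
      calc _ ≤ (1 / ((k:ℝ)+1) ^ 2) ^ 2 * (D * (((k:ℝ)+1) ^ 2)) :=
            mul_le_mul_of_nonneg_left this (by positivity)
        _ = _ := by field_simp
    have hsum : ∑' k, ∫⁻ ω, ENNReal.ofReal (G k ω) ∂P ≠ ⊤ := by
      have h1 : ∀ k, ∫⁻ ω, ENNReal.ofReal (G k ω) ∂P ≤ ENNReal.ofReal (D * (1 / ((k:ℝ)+1) ^ 2)) := by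
        intro k
        rw [← ofReal_integral_eq_lintegral_ofReal (hGi k) (ae_of_all _ (hG0 k))]
        exact ENNReal.ofReal_le_ofReal (hGE k)
      have h2 : Summable fun k : ℕ => D * (1 / ((k:ℝ)+1) ^ 2) := by
        have := (_root_.summable_nat_add_iff (f := fun k : ℕ => 1 / (k:ℝ)^2) 1).2 (Real.summable_one_div_nat_pow.2 (by norm_num : 1 < 2))
        push_cast at this
        exact this.mul_left D
      exact ne_top_of_le_ne_top h2.tsum_ofReal_ne_top (ENNReal.tsum_le_tsum h1)
    rw [← lintegral_tsum (fun k => (hGm k).ennreal_ofReal.aemeasurable)] at hsum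
    have := ae_lt_top (Measurable.tsum fun k => (hGm k).ennreal_ofReal) hsum
    filter_upwards [this] with ω hω
    have h3 := ENNReal.tendsto_atTop_zero_of_tsum_ne_top hω.ne
    have h4 : Tendsto (fun k => G k ω) atTop (𝓝 0) := by
      have := (ENNReal.tendsto_toReal ENNReal.zero_ne_top).comp h3
      refine Tendsto.congr (fun k => ?_) this
      simp [ENNReal.toReal_ofReal (hG0 k ω)]
    have h5 : Tendsto (fun k => √(G k ω)) atTop (𝓝 0) := by
      simpa using h4.sqrt
    simp only [hG, Real.sqrt_sq_eq_abs] at h5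
    exact (tendsto_zero_iff_abs_tendsto_zero _).2 h5
  filter_upwards [hsq] with ω hω
  -- k(T) = floor(sqrt T) - 1
  set k : ℝ → ℕ := fun T => ⌊√T⌋₊ - 1 with hk
  have hkt : Tendsto k atTop atTop := by
    refine (tendsto_sub_atTop_nat 1).comp ?_
    exact tendsto_nat_floor_atTop.comp Real.tendsto_sqrt_atTop
  have hmain := (hω.comp hkt).abs
  have herr : Tendsto (fun T : ℝ => B * (2 * √T + 1) / T) atTop (𝓝 0) := by
    have h1 : Tendsto (fun T : ℝ => B * (2 * (√T)⁻¹ + T⁻¹)) atTop (𝓝 (B * (2 * 0 + 0))) :=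
      (((tendsto_inv_atTop_zero.comp Real.tendsto_sqrt_atTop).const_mul 2).add
        tendsto_inv_atTop_zero).const_mul B
    simp only [mul_zero, add_zero] at h1
    refine h1.congr' ?_
    filter_upwards [eventually_gt_atTop 0] with T hT
    have h2 : (√T)⁻¹ = √T / T := by
      rw [eq_div_iff hT.ne', inv_mul_eq_div, Real.div_sqrt]
    rw [h2]; field_simp
  have hsumt := hmain.add herr
  rw [abs_zero, add_zero] at hsumt
  refine squeeze_zero_norm' ?_ hsumt
  filter_upwards [eventually_ge_atTop 1] with T hT
  have hT0 : 0 < T := by linarith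
  have hs1 : 1 ≤ √T := Real.one_le_sqrt.2 hT
  have hfl : 1 ≤ ⌊√T⌋₊ := (Nat.one_le_floor_iff _).2 hs1
  have hkc : ((k T : ℕ) : ℝ) + 1 = (⌊√T⌋₊ : ℝ) := by
    simp only [hk]; push_cast [Nat.cast_sub hfl]; ring
  simp only [Function.comp, hkc]
  set n : ℝ := (⌊√T⌋₊ : ℝ) with hn
  have hn1 : 1 ≤ n := by rw [hn]; exact_mod_cast hfl
  have hnle : n ≤ √T := Nat.floor_le (by positivity)
  have hnlt : √T < n + 1 := Nat.lt_floor_add_one _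
  have hsT : √T ^ 2 = T := Real.sq_sqrt hT0.le
  have hn2 : n ^ 2 ≤ T := by rw [← hsT]; gcongr
  have hb := hIb ω (n^2) T (by positivity) hn2
  have hd : T - n ^ 2 ≤ 2 * √T + 1 := by nlinarith
  rw [Real.norm_eq_abs]
  change |1 / T * I T ω| ≤ _
  have e : 1 / T * I T ω = 1 / T * I (n^2) ω + (I T ω - I (n^2) ω) / T := by field_simp; ring
  rw [e]
  refine (abs_add_le _ _).trans (add_le_add ?_ ?_)
  · rw [abs_mul, abs_mul, abs_of_pos (show 0 < 1 / T by positivity),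
      abs_of_pos (show 0 < 1 / n ^ 2 by positivity)]
    gcongr
  · rw [abs_div, abs_of_pos hT0]
    gcongr
    exact hb.trans (mul_le_mul_of_nonneg_left hd hB0)

lemma aux_pois_hasSum (r s b : ℝ) :
    HasSum (fun n : ℕ => Real.exp (-r) * r ^ n / n.factorial * (n * s + b * ((n:ℝ) - r) ^ 2))
      ((s + b) * r) := by
  have h0 : HasSum (fun n : ℕ => r ^ n / n.factorial) (Real.exp r) := by
    rw [Real.exp_eq_exp_ℝ]
    exact NormedSpace.expSeries_div_hasSum_exp r
  have h1 : HasSum (fun n : ℕ => r ^ n / n.factorial * n) (r * Real.exp r) := by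
    rw [← hasSum_nat_add_iff' 1]
    simp only [Finset.range_one, Finset.sum_singleton, Nat.cast_zero, mul_zero, sub_zero]
    refine (h0.mul_left r).congr_fun fun n => ?_
    rw [Nat.factorial_succ]
    push_cast
    have : (n.factorial : ℝ) ≠ 0 := by positivity
    field_simp
    ring
  have h2 : HasSum (fun n : ℕ => r ^ n / n.factorial * (n * (n - 1))) (r ^ 2 * Real.exp r) := by
    rw [← hasSum_nat_add_iff' 2]
    simp only [Finset.sum_range_succ, Finset.range_zero, Finset.sum_empty, Nat.cast_zero, Nat.cast_one]
    norm_num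
    refine (h0.mul_left (r^2)).congr_fun fun n => ?_
    rw [show n + 2 = (n+1)+1 by rfl, Nat.factorial_succ, Nat.factorial_succ]
    push_cast
    have : (n.factorial : ℝ) ≠ 0 := by positivity
    field_simp
    ring
  have h3 := (((h2.mul_left b).add (h1.mul_left (s + b - 2 * b * r))).add (h0.mul_left (b * r^2))).mul_left
    (Real.exp (-r))
  have e : (s + b) * r = Real.exp (-r) * (b * (r ^ 2 * Real.exp r) + (s + b - 2 * b * r) * (r * Real.exp r)
      + b * r ^ 2 * Real.exp r) := by
    have : Real.exp (-r) * Real.exp r = 1 := by rw [← Real.exp_add]; simp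
    calc (s + b) * r = (Real.exp (-r) * Real.exp r) * ((s + b) * r) := by rw [this, one_mul]
      _ = _ := by ring
  rw [e]
  exact h3.congr_fun fun n => by ring

lemma aux_pois_lint (r : ℝ≥0) (s b : ℝ) (hs : 0 ≤ s) (hb : 0 ≤ b) :
    ∫⁻ n : ℕ, ENNReal.ofReal (n * s + b * ((n:ℝ) - r) ^ 2) ∂(poissonMeasure r) =
      ENNReal.ofReal ((s + b) * r) := by
  have h := aux_pois_hasSum r s b
  have h0 : ∀ n : ℕ, 0 ≤ n * s + b * ((n:ℝ) - r) ^ 2 := fun n => by positivity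
  have hi : Integrable (fun n : ℕ => n * s + b * ((n:ℝ) - r) ^ 2) (poissonMeasure r) := by
    rw [integrable_poissonMeasure_iff]
    simp_rw [Real.norm_eq_abs, fun n => abs_of_nonneg (h0 n)]
    exact h.summable
  rw [← ofReal_integral_eq_lintegral_ofReal hi (ae_of_all _ h0), integral_poissonMeasure]
  simp_rw [smul_eq_mul]
  rw [h.tsum_eq]

lemma aux_sum_sq {Ω : Type*} [MeasurableSpace Ω] (P : Measure Ω) [IsProbabilityMeasure P]
    (ξ : ℕ → Ω → ℝ) (a σ : ℝ) (hindep : iIndepFun ξ P)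
    (hident : ∀ i, IdentDistrib (ξ i) (ξ 0) P P) (hL2 : MemLp (ξ 0) 2 P)
    (hmean : ∫ ω, ξ 0 ω ∂P = a) (hvar : variance (ξ 0) P = σ ^ 2) (n : ℕ) (c : ℝ) :
    ∫⁻ ω, ENNReal.ofReal ((∑ i ∈ Finset.range n, ξ i ω - a * c) ^ 2) ∂P =
      ENNReal.ofReal (n * σ ^ 2 + a ^ 2 * ((n : ℝ) - c) ^ 2) := by
  have hL : ∀ i, MemLp (ξ i) 2 P := fun i => (hident i).memLp_iff.2 hL2
  have hS : MemLp (fun ω => ∑ i ∈ Finset.range n, ξ i ω) 2 P := memLp_finsetSum _ fun i _ => hL i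
  have hS' : MemLp (fun ω => ∑ i ∈ Finset.range n, ξ i ω - a * c) 2 P := hS.sub (memLp_const _)
  rw [← ofReal_integral_eq_lintegral_ofReal hS'.integrable_sq (ae_of_all _ fun ω => sq_nonneg _)]
  congr 1
  have hv := variance_eq_sub hS'
  have hv2 : variance (fun ω => ∑ i ∈ Finset.range n, ξ i ω - a * c) P = n * σ ^ 2 := by
    rw [variance_sub_const hS.aestronglyMeasurable]
    have := IndepFun.variance_sum (μ := P) (X := ξ) (s := Finset.range n) (fun i _ => hL i)
      (fun i _ j _ hij => hindep.indepFun hij)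
    have e : (fun ω => ∑ i ∈ Finset.range n, ξ i ω) = ∑ i ∈ Finset.range n, ξ i := by ext; simp
    rw [e, this]
    simp_rw [fun i => (hident i).variance_eq, hvar]
    simp
  have hm : ∫ ω, (∑ i ∈ Finset.range n, ξ i ω - a * c) ∂P = a * (n - c) := by
    rw [integral_sub (hS.integrable (by simp)) (integrable_const _),
      integral_finsetSum _ fun i _ => (hL i).integrable (by simp)]
    simp_rw [fun i => (hident i).integral_eq, hmean]
    simp; ring
  rw [hv2, hm] at hv
  simp only [Pi.pow_apply] at hv
  linarith

lemma aux_indep_integral {Ω α β E : Type*} [MeasurableSpace Ω] [MeasurableSpace α] [MeasurableSpace β]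
    [NormedAddCommGroup E] [NormedSpace ℝ E] [MeasurableSpace E] [BorelSpace E]
    [SecondCountableTopology E]
    {P : Measure Ω} [IsProbabilityMeasure P] {X : Ω → α} {N : Ω → β} (hX : Measurable X)
    (hN : Measurable N) (h : IndepFun X N P) (Φ : α → β → E) (hΦ : Measurable (Function.uncurry Φ))
    (B : ℝ) (hB : ∀ x y, ‖Φ x y‖ ≤ B) :
    ∫ ω, Φ (X ω) (N ω) ∂P = ∫ ω, ∫ ω', Φ (X ω') (N ω) ∂P ∂P := by
  have h1 := (indepFun_iff_map_prod_eq_prod_map_map hX.aemeasurable hN.aemeasurable).1 h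
  have := Measure.isProbabilityMeasure_map (μ := P) hX.aemeasurable
  have := Measure.isProbabilityMeasure_map (μ := P) hN.aemeasurable
  have e1 : ∫ ω, Φ (X ω) (N ω) ∂P = ∫ z, Function.uncurry Φ z ∂(P.map fun ω => (X ω, N ω)) := by
    rw [integral_map (hX.prodMk hN).aemeasurable hΦ.aestronglyMeasurable]; rfl
  rw [e1, h1]
  have hint : Integrable (Function.uncurry Φ) ((P.map X).prod (P.map N)) :=
    Integrable.of_bound hΦ.aestronglyMeasurable B (ae_of_all _ fun z => hB _ _)
  rw [integral_prod_symm _ hint, integral_map hN.aemeasurable hint.integral_prod_right.aestronglyMeasurable]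
  refine integral_congr_ae (ae_of_all _ fun ω => ?_)
  simp only
  exact integral_map (f := fun x => Function.uncurry Φ (x, N ω)) hX.aemeasurable
    (hΦ.comp (measurable_id.prodMk measurable_const)).aestronglyMeasurable

lemma aux_indep_lintegral {Ω α β : Type*} [MeasurableSpace Ω] [MeasurableSpace α] [MeasurableSpace β]
    {P : Measure Ω} [IsProbabilityMeasure P] {X : Ω → α} {N : Ω → β} (hX : Measurable X)
    (hN : Measurable N) (h : IndepFun X N P) (Φ : α → β → ENNReal) (hΦ : Measurable (Function.uncurry Φ)) :
    ∫⁻ ω, Φ (X ω) (N ω) ∂P = ∫⁻ ω, ∫⁻ ω', Φ (X ω') (N ω) ∂P ∂P := by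
  have h1 := (indepFun_iff_map_prod_eq_prod_map_map hX.aemeasurable hN.aemeasurable).1 h
  have := Measure.isProbabilityMeasure_map (μ := P) hX.aemeasurable
  have := Measure.isProbabilityMeasure_map (μ := P) hN.aemeasurable
  have e1 : ∫⁻ ω, Φ (X ω) (N ω) ∂P = ∫⁻ z, Function.uncurry Φ z ∂(P.map fun ω => (X ω, N ω)) := by
    rw [lintegral_map hΦ (hX.prodMk hN)]; rfl
  rw [e1, h1, lintegral_prod_symm _ hΦ.aemeasurable, lintegral_map hΦ.lintegral_prod_left' hN]
  refine lintegral_congr fun ω => ?_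
  exact lintegral_map (f := fun x => Function.uncurry Φ (x, N ω))
    (hΦ.comp (measurable_id.prodMk measurable_const)) hX

lemma aux_meas_sum : Measurable (Function.uncurry fun (x : ℕ → ℝ) (n : ℕ) => ∑ i ∈ Finset.range n, x i) := by
  refine measurable_from_prod_countable_left fun n => ?_
  simp only [Function.uncurry]
  fun_prop

lemma aux_shift_law {Ω : Type*} [MeasurableSpace Ω] (P : Measure Ω) [IsProbabilityMeasure P]
    (ξ : ℕ → Ω → ℝ) (hmeas : ∀ i, Measurable (ξ i)) (hindep : iIndepFun ξ P)
    (hident : ∀ i, IdentDistrib (ξ i) (ξ 0) P P) (n m : ℕ) (H : ℝ → ℝ) (hH : Measurable H) :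
    ∫ ω, H (∑ i ∈ Finset.range m, ξ (n + i) ω) ∂P = ∫ ω, H (∑ i ∈ Finset.range m, ξ i ω) ∂P := by
  have h1 : iIndepFun (fun i => ξ (n + i)) P := hindep.precomp (g := fun i => n + i)
    (fun a b h => by simpa using h)
  have h2 : IdentDistrib (fun ω => fun i => ξ (n + i) ω) (fun ω => fun i => ξ i ω) P P :=
    IdentDistrib.pi (fun i => (hident _).trans (hident i).symm) h1 hindep
  have h3 := h2.comp (u := fun x : ℕ → ℝ => H (∑ i ∈ Finset.range m, x i)) (by fun_prop)
  exact h3.integral_eq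

lemma aux_split {Ω : Type*} [MeasurableSpace Ω] (P : Measure Ω) [IsProbabilityMeasure P]
    (ξ : ℕ → Ω → ℝ) (hmeas : ∀ i, Measurable (ξ i)) (hindep : iIndepFun ξ P)
    (hident : ∀ i, IdentDistrib (ξ i) (ξ 0) P P) (n m : ℕ) (G H : ℝ → ℝ) (hG : Measurable G)
    (hH : Measurable H) :
    ∫ ω, G (∑ i ∈ Finset.range n, ξ i ω) * H (∑ i ∈ Finset.range m, ξ (n + i) ω) ∂P =
     (∫ ω, G (∑ i ∈ Finset.range n, ξ i ω) ∂P) * ∫ ω, H (∑ i ∈ Finset.range m, ξ i ω) ∂P := by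
  rw [← aux_shift_law P ξ hmeas hindep hident n m H hH]
  have h1 := hindep.indepFun_finset (Finset.range n) ((Finset.range m).map (addLeftEmbedding n))
    (by
      rw [Finset.disjoint_left]
      intro i hi hi2
      simp at hi hi2
      omega) hmeas
  have h2 := h1.comp (φ := fun x => G (∑ i, x i)) (ψ := fun x => H (∑ i, x i)) (by fun_prop) (by fun_prop)
  have e1 : (fun x => G (∑ i, x i)) ∘ (fun a (i : Finset.range n) => ξ i a) = fun ω => G (∑ i ∈ Finset.range n, ξ i ω) := by
    ext ω
    simp only [Function.comp]
    rw [← Finset.sum_coe_sort (Finset.range n) (fun i => ξ i ω)]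
  have e2 : (fun x => H (∑ i, x i)) ∘ (fun a (i : (Finset.range m).map (addLeftEmbedding n)) => ξ i a) = fun ω => H (∑ i ∈ Finset.range m, ξ (n + i) ω) := by
    ext ω
    simp only [Function.comp]
    rw [Finset.sum_coe_sort ((Finset.range m).map (addLeftEmbedding n)) (fun i => ξ i ω), Finset.sum_map]
    rfl
  rw [e1, e2] at h2
  exact h2.integral_fun_mul_eq_mul_integral
    (Measurable.aestronglyMeasurable (by fun_prop)) (Measurable.aestronglyMeasurable (by fun_prop))

lemma aux_c5 {Ω : Type*} [MeasurableSpace Ω] (P : Measure Ω) [IsProbabilityMeasure P]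
    (ξ : ℕ → Ω → ℝ) (hmeas : ∀ i, Measurable (ξ i)) (hindep : iIndepFun ξ P)
    (hident : ∀ i, IdentDistrib (ξ i) (ξ 0) P P) (N M : Ω → ℕ) (hN : Measurable N) (hM : Measurable M)
    (hNM : IndepFun N M P) (hξ : IndepFun (fun ω => fun i => ξ i ω) (fun ω => (N ω, M ω)) P)
    (G H : ℝ → ℝ) (hG : Measurable G)
    (hH : Measurable H) (B : ℝ) (hGB : ∀ x, |G x| ≤ B) (hHB : ∀ x, |H x| ≤ B) :
    ∫ ω, G (∑ i ∈ Finset.range (N ω), ξ i ω) * H (∑ i ∈ Finset.range (M ω), ξ (N ω + i) ω) ∂P =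
     (∫ ω, ∫ ω', G (∑ i ∈ Finset.range (N ω), ξ i ω') ∂P ∂P) *
       ∫ ω, ∫ ω', H (∑ i ∈ Finset.range (M ω), ξ i ω') ∂P ∂P := by
  have hB0 : 0 ≤ B := (abs_nonneg _).trans (hGB 0)
  have h1 := aux_indep_integral (measurable_pi_lambda _ hmeas) (hN.prodMk hM) hξ
    (fun x p => G (∑ i ∈ Finset.range p.1, x i) * H (∑ i ∈ Finset.range p.2, x (p.1 + i)))
    (by
      refine measurable_from_prod_countable_left fun p => ?_
      simp only [Function.uncurry]
      fun_prop) (B * B) (fun x p => by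
        rw [Real.norm_eq_abs, abs_mul]
        exact mul_le_mul (hGB _) (hHB _) (abs_nonneg _) hB0)
  simp only at h1
  rw [h1]
  simp_rw [aux_split P ξ hmeas hindep hident _ _ G H hG hH]
  have h2 := hNM.comp (φ := fun n => ∫ ω', G (∑ i ∈ Finset.range n, ξ i ω') ∂P)
    (ψ := fun n => ∫ ω', H (∑ i ∈ Finset.range n, ξ i ω') ∂P) (measurable_of_countable _)
    (measurable_of_countable _)
  exact h2.integral_fun_mul_eq_mul_integral
    ((measurable_of_countable (fun n => ∫ ω', G (∑ i ∈ Finset.range n, ξ i ω') ∂P)).comp hN).aestronglyMeasurable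
    ((measurable_of_countable (fun n => ∫ ω', H (∑ i ∈ Finset.range n, ξ i ω') ∂P)).comp hM).aestronglyMeasurable

lemma aux_c6 {Ω : Type*} [MeasurableSpace Ω] (P : Measure Ω) [IsProbabilityMeasure P]
    (ξ : ℕ → Ω → ℝ) (hmeas : ∀ i, Measurable (ξ i)) (hindep : iIndepFun ξ P)
    (hident : ∀ i, IdentDistrib (ξ i) (ξ 0) P P) (N M : Ω → ℕ) (hN : Measurable N) (hM : Measurable M)
    (hNM : IndepFun N M P) (hξ : IndepFun (fun ω => fun i => ξ i ω) (fun ω => (N ω, M ω)) P)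
    (G H : ℝ → ℝ) (hG : Measurable G)
    (hH : Measurable H) (B : ℝ) (hGB : ∀ x, |G x| ≤ B) (hHB : ∀ x, |H x| ≤ B) :
    ∫ ω, G (∑ i ∈ Finset.range (N ω), ξ i ω) * H (∑ i ∈ Finset.range (M ω), ξ (N ω + i) ω) ∂P =
     (∫ ω, G (∑ i ∈ Finset.range (N ω), ξ i ω) ∂P) *
       ∫ ω, H (∑ i ∈ Finset.range (M ω), ξ (N ω + i) ω) ∂P := by
  have h1 := aux_c5 P ξ hmeas hindep hident N M hN hM hNM hξ G H hG hH B hGB hHB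
  have h2 := aux_c5 P ξ hmeas hindep hident N M hN hM hNM hξ G (fun _ => 1) hG measurable_const
    (max B 1) (fun x => (hGB x).trans (le_max_left _ _)) (fun x => by simp)
  have h3 := aux_c5 P ξ hmeas hindep hident N M hN hM hNM hξ (fun _ => 1) H measurable_const hH
    (max B 1) (fun x => by simp) (fun x => (hHB x).trans (le_max_left _ _))
  simp at h2 h3
  rw [h1, h2, h3]

lemma aux_charFun_compound {Ω : Type*} [MeasurableSpace Ω] (P : Measure Ω) [IsProbabilityMeasure P]
    (ξ : ℕ → Ω → ℝ) (hmeas : ∀ i, Measurable (ξ i)) (hindep : iIndepFun ξ P)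
    (hident : ∀ i, IdentDistrib (ξ i) (ξ 0) P P) (N : Ω → ℕ) (hN : Measurable N)
    (r : ℝ≥0) (hlaw : P.map N = poissonMeasure r)
    (hξ : IndepFun (fun ω => fun i => ξ i ω) N P) (a u : ℝ) :
    ∫ ω, Complex.exp (u * ((∑ i ∈ Finset.range (N ω), ξ i ω - a * r : ℝ) : ℂ) * Complex.I) ∂P =
      Complex.exp (r * (charFun (P.map (ξ 0)) u - 1 - a * u * Complex.I)) := by
  set φ := charFun (P.map (ξ 0)) u with hφ
  have h1 := aux_indep_integral (measurable_pi_lambda _ hmeas) hN hξ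
    (fun x n => Complex.exp (u * ((∑ i ∈ Finset.range n, x i - a * r : ℝ) : ℂ) * Complex.I))
    (by
      refine measurable_from_prod_countable_left fun p => ?_
      simp only [Function.uncurry]
      fun_prop) 1 (fun x n => by
        rw [← Complex.ofReal_mul, Complex.norm_exp_ofReal_mul_I])
  simp only at h1
  rw [h1]
  have h2 : ∀ n : ℕ, ∫ ω', Complex.exp (u * ((∑ i ∈ Finset.range n, ξ i ω' - a * r : ℝ) : ℂ) * Complex.I) ∂P
      = Complex.exp (-(r * a * u * Complex.I)) * φ ^ n := by
    intro n
    have h3 : charFun (P.map (fun ω ↦ ∑ i ∈ Finset.range n, ξ i ω)) u = φ ^ n := by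
      rw [(hindep.restrict _).charFun_map_fun_finsetSum_eq_prod (fun i _ ↦ (hmeas i).aemeasurable)]
      simp [fun i ↦ (hident i).map_eq, hφ]
    rw [← h3, charFun_apply_real, integral_map (by fun_prop) (by fun_prop), ← integral_const_mul]
    congr 1
    ext ω
    rw [← Complex.exp_add]
    congr 1
    push_cast
    ring
  simp_rw [h2]
  rw [← integral_map (f := fun n : ℕ => Complex.exp (-(r * a * u * Complex.I)) * φ ^ n) hN.aemeasurable
    (measurable_of_countable _).aestronglyMeasurable, hlaw, integral_const_mul, integral_poissonMeasure]
  have h4 : ∀ n : ℕ, (Real.exp (-r) * r ^ n / n.factorial : ℝ) • φ ^ n =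
      Complex.exp (-r) * ((r * φ) ^ n / n.factorial) := by
    intro n
    rw [Complex.real_smul]
    push_cast
    ring
  simp_rw [h4]
  rw [_root_.tsum_mul_left, (NormedSpace.expSeries_div_hasSum_exp ((r : ℂ) * φ)).tsum_eq, ← Complex.exp_eq_exp_ℂ,
    ← Complex.exp_add, ← Complex.exp_add]
  congr 1
  ring

lemma aux_taylor {Ω : Type*} [MeasurableSpace Ω] (P : Measure Ω) [IsProbabilityMeasure P]
    (X : Ω → ℝ) (hX : Measurable X) (hL2 : MemLp X 2 P) (t : ℝ) :
    Tendsto (fun r : ℝ => (r : ℂ) * (charFun (P.map X) (t / √r) - 1 - (∫ ω, X ω ∂P : ℝ) * (t / √r : ℝ) * Complex.I))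
      atTop (𝓝 (-((∫ ω, X ω ^ 2 ∂P : ℝ) * t ^ 2 / 2))) := by
  have := Measure.isProbabilityMeasure_map (μ := P) hX.aemeasurable
  have hid : MemLp id 2 (P.map X) := by
    rw [memLp_map_measure_iff aestronglyMeasurable_id hX.aemeasurable]; exact hL2
  set m := ∫ ω, X ω ∂P
  set v := ∫ ω, X ω ^ 2 ∂P
  have h1 : (fun u : ℝ ↦ charFun (P.map X) u - (1 + (m:ℂ) * u * Complex.I - (v:ℂ) * u ^ 2 / 2)) =o[𝓝 0]
      fun u ↦ u ^ 2 := by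
    have h := fun u => taylorWithinEval_charFun_two_zero (P := P) (X := X) hX.aemeasurable hid u
    have h2 : (fun u : ℝ ↦ charFun (P.map X) u - taylorWithinEval (charFun (P.map X)) 2 Set.univ 0 u) =o[𝓝 0]
      fun u ↦ (u - 0) ^ 2 := taylor_isLittleO_univ (contDiff_charFun (by exact_mod_cast hid))
    simp_rw [h, sub_zero] at h2
    exact h2
  have hu : Tendsto (fun r : ℝ => t / √r) atTop (𝓝 0) :=
    Real.tendsto_sqrt_atTop.const_div_atTop t
  have h2 := h1.comp_tendsto hu
  have h3 : (fun r : ℝ => (t / √r) ^ 2) =O[atTop] fun r : ℝ => r⁻¹ := by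
    refine Asymptotics.IsBigO.of_bound (t ^ 2) ?_
    filter_upwards [eventually_gt_atTop 0] with r hr
    rw [div_pow, Real.sq_sqrt hr.le]
    simp [div_eq_mul_inv]
  have h4 := h2.trans_isBigO h3
  have h5 : Tendsto (fun r : ℝ => (r : ℂ) * (charFun (P.map X) (t / √r) - (1 + (m:ℂ) * (t / √r : ℝ) * Complex.I - (v:ℂ) * (t / √r : ℝ) ^ 2 / 2))) atTop (𝓝 0) := by
    rw [tendsto_zero_iff_norm_tendsto_zero]
    have h6 := h4.norm_left.tendsto_div_nhds_zero
    refine h6.congr' ?_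
    filter_upwards [eventually_gt_atTop 0] with r hr
    simp only [Function.comp]
    rw [norm_mul, Complex.norm_real, Real.norm_eq_abs, abs_of_pos hr, div_inv_eq_mul, mul_comm]
  have h7 := h5.sub_const ((v:ℂ) * t ^ 2 / 2)
  rw [zero_sub] at h7
  refine h7.congr' ?_
  filter_upwards [eventually_gt_atTop 0] with r hr
  have h8 : ((t / √r : ℝ) : ℂ) ^ 2 = t ^ 2 / r := by
    rw [← Complex.ofReal_pow, div_pow, Real.sq_sqrt hr.le]; push_cast; rfl
  have hr' : (r : ℂ) ≠ 0 := by exact_mod_cast hr.ne'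
  rw [h8]
  field_simp
  ring

lemma aux_clt {Ω : Type*} [MeasurableSpace Ω] (P : Measure Ω) [IsProbabilityMeasure P]
    (ξ : ℕ → Ω → ℝ) (a σ : ℝ) (hmeas : ∀ i, Measurable (ξ i)) (hindep : iIndepFun ξ P)
    (hident : ∀ i, IdentDistrib (ξ i) (ξ 0) P P)  (hL2 : MemLp (ξ 0) 2 P)
    (hmean : ∫ ω, ξ 0 ω ∂P = a) (hvar : variance (ξ 0) P = σ ^ 2)
    (π : ℝ → Ω → ℕ) (hπmeas : ∀ t, Measurable (π t))
    (hlaw : ∀ r, 0 < r → P.map (π r) = poissonMeasure r.toNNReal)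
    (hξ : ∀ r, IndepFun (fun ω => fun i => ξ i ω) (π r) P) (g : BoundedContinuousFunction ℝ ℝ) :
    Tendsto (fun r : ℝ => ∫ ω, g ((∑ i ∈ Finset.range (π r ω), ξ i ω - a * r) / √r) ∂P) atTop
      (𝓝 (∫ y, g y ∂(gaussianReal 0 (σ ^ 2 + a ^ 2).toNNReal))) := by
  have hXm : ∀ r, Measurable fun ω => (∑ i ∈ Finset.range (π r ω), ξ i ω - a * r) / √r := by
    intro r
    exact ((aux_meas_sum.comp ((measurable_pi_lambda _ hmeas).prodMk (hπmeas r))).sub_const _).div_const _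
  have hsec : ∫ ω, ξ 0 ω ^ 2 ∂P = σ ^ 2 + a ^ 2 := by
    have := variance_eq_sub hL2
    rw [hvar, hmean] at this
    simp only [Pi.pow_apply] at this
    linarith
  refine tendsto_of_seq_tendsto fun s hs => ?_
  have hpm : ∀ r, IsProbabilityMeasure (P.map fun ω => (∑ i ∈ Finset.range (π r ω), ξ i ω - a * r) / √r) :=
    fun r => Measure.isProbabilityMeasure_map (hXm r).aemeasurable
  let ρ : ℝ → ProbabilityMeasure ℝ := fun r => ⟨P.map fun ω => (∑ i ∈ Finset.range (π r ω), ξ i ω - a * r) / √r, hpm r⟩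
  let ρ0 : ProbabilityMeasure ℝ := ⟨gaussianReal 0 (σ ^ 2 + a ^ 2).toNNReal, inferInstance⟩
  have key : Tendsto (fun n => ρ (s n)) atTop (𝓝 ρ0) := by
    refine ProbabilityMeasure.tendsto_iff_tendsto_charFun.2 fun t => ?_
    simp only [ρ, ρ0, ProbabilityMeasure.coe_mk]
    rw [charFun_gaussianReal]
    have h1 := ((Complex.continuous_exp.tendsto _).comp (aux_taylor P (ξ 0) (hmeas 0) hL2 t)).comp hs
    rw [hsec, hmean] at h1
    have e : Complex.exp (t * (0:ℝ) * Complex.I - ((σ ^ 2 + a ^ 2).toNNReal : ℝ) * t ^ 2 / 2) =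
      Complex.exp (-(((σ ^ 2 + a ^ 2 : ℝ) : ℂ) * t ^ 2 / 2)) := by
      rw [Real.coe_toNNReal _ (by positivity)]; simp
    refine Tendsto.congr' ?_ (by convert h1 using 2)
    filter_upwards [hs.eventually_gt_atTop 0] with n hn
    have h2 := aux_charFun_compound P ξ hmeas hindep hident (π (s n)) (hπmeas _) (s n).toNNReal
      (hlaw _ hn) (hξ _) a (t / √(s n))
    rw [Real.coe_toNNReal _ hn.le] at h2
    rw [charFun_apply_real, integral_map (hXm _).aemeasurable (by fun_prop)]
    simp only [Function.comp]
    rw [← h2]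
    congr 1
    ext ω
    congr 2
    push_cast
    ring
  have h3 := (ProbabilityMeasure.tendsto_iff_forall_integral_tendsto.1 key) g
  simp only [ρ, ρ0, ProbabilityMeasure.coe_mk] at h3
  refine h3.congr fun n => ?_
  rw [integral_map (hXm _).aemeasurable g.continuous.aestronglyMeasurable]
  rfl

lemma aux_law {Ω : Type*} [MeasurableSpace Ω] (P : Measure Ω) [IsProbabilityMeasure P] 
    (π : ℝ → Ω → ℕ) (hπmeas : ∀ t, Measurable (π t)) (hπ0 : ∀ᵐ ω ∂P, π 0 ω = 0)
    (hπdist : ∀ s t : ℝ, 0 ≤ s → s < t →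
      Measure.map (fun ω => (π t ω : ℝ) - (π s ω : ℝ)) P
        = Measure.map (fun n : ℕ => (n : ℝ)) (poissonMeasure (t - s).toNNReal)) (r : ℝ) (hr : 0 < r) :
    P.map (π r) = poissonMeasure r.toNNReal := by
  have h := hπdist 0 r le_rfl hr
  rw [sub_zero] at h
  have h1 : Measure.map (fun ω => (π r ω : ℝ) - (π 0 ω : ℝ)) P = (P.map (π r)).map (fun n : ℕ => (n : ℝ)) := by
    rw [Measure.map_map (by fun_prop) (hπmeas r)]
    refine Measure.map_congr ?_
    filter_upwards [hπ0] with ω hω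
    simp [hω]
  rw [h1] at h
  have hfl : Measurable (fun x : ℝ => ⌊x⌋₊) := Nat.measurable_floor
  have h2 := congrArg (Measure.map (fun x : ℝ => ⌊x⌋₊)) h
  rw [Measure.map_map hfl (by fun_prop), Measure.map_map hfl (by fun_prop)] at h2
  have h3 : (fun x : ℝ => ⌊x⌋₊) ∘ (fun n : ℕ => (n : ℝ)) = id := by ext n; simp
  rwa [h3, Measure.map_id, Measure.map_id] at h2

lemma aux_mono {Ω : Type*} [MeasurableSpace Ω] (P : Measure Ω) [IsProbabilityMeasure P] 
    (π : ℝ → Ω → ℕ) (hπmeas : ∀ t, Measurable (π t)) 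
    (hπdist : ∀ s t : ℝ, 0 ≤ s → s < t →
      Measure.map (fun ω => (π t ω : ℝ) - (π s ω : ℝ)) P
        = Measure.map (fun n : ℕ => (n : ℝ)) (poissonMeasure (t - s).toNNReal)) (s t : ℝ) (hs : 0 ≤ s) (hst : s ≤ t) :
    ∀ᵐ ω ∂P, π s ω ≤ π t ω := by
  rcases hst.eq_or_lt with rfl | hst
  · simp
  have h := hπdist s t hs hst
  have hm : ∀ t, Measurable fun ω => (π t ω : ℝ) := fun t => measurable_from_top.comp (hπmeas t)
  have h1 : ∀ᵐ x ∂(Measure.map (fun ω => (π t ω : ℝ) - (π s ω : ℝ)) P), 0 ≤ x := by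
    rw [h, ae_map_iff (by fun_prop) measurableSet_Ici]
    simp
  have hm2 : Measurable fun ω => (π t ω : ℝ) - (π s ω : ℝ) := (hm t).sub (hm s)
  rw [ae_map_iff hm2.aemeasurable measurableSet_Ici] at h1
  filter_upwards [h1] with ω hω
  exact_mod_cast sub_nonneg.1 hω

lemma aux_NM_indep {Ω : Type*} [MeasurableSpace Ω] (P : Measure Ω) [IsProbabilityMeasure P] 
    (π : ℝ → Ω → ℕ) (hπ0 : ∀ᵐ ω ∂P, π 0 ω = 0)
    (hπindep : ∀ (k : ℕ) (t : Fin (k + 1) → ℝ), Monotone t → 0 ≤ t 0 →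
      iIndepFun
        (fun i : Fin k => fun ω => (π (t i.succ) ω : ℝ) - (π (t i.castSucc) ω : ℝ)) P)
    (s t : ℝ) (hs : 0 ≤ s) (hst : s ≤ t) :
    IndepFun (π s) (fun ω => π t ω - π s ω) P := by
  have h := hπindep 2 ![0, s, t] (by
    intro i j hij
    fin_cases i <;> fin_cases j <;> simp_all <;> linarith) (by simp)
  have h2 := h.indepFun (i := 0) (j := 1) (by simp)
  have hfl : Measurable (fun x : ℝ => ⌊x⌋₊) := Nat.measurable_floor
  have h3 := h2.comp hfl hfl
  refine h3.congr ?_ ?_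
  · filter_upwards [hπ0] with ω hω
    simp [hω]
  · refine Eventually.of_forall fun ω => ?_
    simp only [Function.comp]
    have e : (![0, s, t] : Fin 3 → ℝ) (Fin.succ (1 : Fin 2)) = t := rfl
    have e' : (![0, s, t] : Fin 3 → ℝ) (Fin.castSucc (1 : Fin 2)) = s := rfl
    rw [e, e', Nat.floor_sub_natCast, Nat.floor_natCast]

lemma aux_first {Ω : Type*} [MeasurableSpace Ω] (P : Measure Ω) [IsProbabilityMeasure P] 
    (ξ : ℕ → Ω → ℝ) (a σ : ℝ) (hmeas : ∀ i, Measurable (ξ i)) (hindep : iIndepFun ξ P)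
    (hident : ∀ i, IdentDistrib (ξ i) (ξ 0) P P)  (hL2 : MemLp (ξ 0) 2 P)
    (hmean : ∫ ω, ξ 0 ω ∂P = a) (hvar : variance (ξ 0) P = σ ^ 2)
    (N : Ω → ℕ) (hN : Measurable N) (r : ℝ) (hr : 0 < r) (hlaw : P.map N = poissonMeasure r.toNNReal)
    (hξ : IndepFun (fun ω => fun i => ξ i ω) N P) :
    Integrable (fun ω => ∑ i ∈ Finset.range (N ω), ξ i ω - a * r) P ∧
    ∫ ω, |∑ i ∈ Finset.range (N ω), ξ i ω - a * r| ∂P ≤ √(σ ^ 2 + a ^ 2 + 1) * √r := by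
  have hXi : Measurable fun ω => fun i => ξ i ω := measurable_pi_lambda _ hmeas
  have hZ : Measurable fun ω => ∑ i ∈ Finset.range (N ω), ξ i ω - a * r :=
    (aux_meas_sum.comp (hXi.prodMk hN)).sub_const _
  have h1 : ∫⁻ ω, ENNReal.ofReal ((∑ i ∈ Finset.range (N ω), ξ i ω - a * r) ^ 2) ∂P
      = ENNReal.ofReal ((σ ^ 2 + a ^ 2) * r) := by
    rw [aux_indep_lintegral hXi hN hξ (fun x n => ENNReal.ofReal ((∑ i ∈ Finset.range n, x i - a * r) ^ 2))
      (by exact ((aux_meas_sum.sub_const (a * r)).pow_const 2).ennreal_ofReal)]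
    simp_rw [aux_sum_sq P ξ a σ hindep hident hL2 hmean hvar]
    have h2 := aux_pois_lint r.toNNReal (σ ^ 2) (a ^ 2) (by positivity) (by positivity)
    rw [← hlaw, lintegral_map measurable_from_top hN, Real.coe_toNNReal _ hr.le] at h2
    exact h2
  have hsq : Integrable (fun ω => (∑ i ∈ Finset.range (N ω), ξ i ω - a * r) ^ 2) P := by
    refine ⟨(hZ.pow_const _).aestronglyMeasurable, ?_⟩
    rw [hasFiniteIntegral_iff_ofReal (Eventually.of_forall fun ω => sq_nonneg _), h1]
    exact ENNReal.ofReal_lt_top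
  have hsqi : ∫ ω, (∑ i ∈ Finset.range (N ω), ξ i ω - a * r) ^ 2 ∂P = (σ ^ 2 + a ^ 2) * r := by
    rw [integral_eq_lintegral_of_nonneg_ae (Eventually.of_forall fun ω => sq_nonneg _) hsq.1, h1,
      ENNReal.toReal_ofReal (by positivity)]
  have hi : Integrable (fun ω => ∑ i ∈ Finset.range (N ω), ξ i ω - a * r) P :=
    ((memLp_two_iff_integrable_sq hZ.aestronglyMeasurable).2 hsq).integrable (by norm_num)
  refine ⟨hi, ?_⟩
  set q := √(σ ^ 2 + a ^ 2 + 1) * √r with hq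
  have hq0 : 0 < q := by positivity
  have hq2 : q ^ 2 = (σ ^ 2 + a ^ 2 + 1) * r := by
    rw [hq, mul_pow, Real.sq_sqrt (by positivity), Real.sq_sqrt hr.le]
  have h3 : ∫ ω, |∑ i ∈ Finset.range (N ω), ξ i ω - a * r| ∂P ≤
      ∫ ω, ((∑ i ∈ Finset.range (N ω), ξ i ω - a * r) ^ 2 * (1 / (2 * q)) + q / 2) ∂P := by
    refine integral_mono hi.abs ((hsq.mul_const _).add (integrable_const _)) fun ω => ?_
    simp only
    set z := ∑ i ∈ Finset.range (N ω), ξ i ω - a * r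
    have : |z| ^ 2 = z ^ 2 := sq_abs z
    rw [← this]
    have : |z| ^ 2 * (1 / (2 * q)) + q / 2 - |z| = (|z| - q) ^ 2 / (2 * q) := by field_simp; ring
    have : 0 ≤ (|z| - q) ^ 2 / (2 * q) := by positivity
    linarith
  refine h3.trans ?_
  rw [integral_add (hsq.mul_const _) (integrable_const _), integral_mul_const, hsqi]
  simp only [integral_const, probReal_univ, one_smul]
  have : (σ ^ 2 + a ^ 2) * r ≤ q ^ 2 := by rw [hq2]; nlinarith
  have : (σ ^ 2 + a ^ 2) * r * (1 / (2 * q)) ≤ q ^ 2 * (1 / (2 * q)) := by gcongr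
  have : q ^ 2 * (1 / (2 * q)) = q / 2 := by field_simp
  linarith

lemma aux_cov {Ω : Type*} [MeasurableSpace Ω] (P : Measure Ω) [IsProbabilityMeasure P] 
    (ξ : ℕ → Ω → ℝ) (a σ : ℝ) (hmeas : ∀ i, Measurable (ξ i)) (hindep : iIndepFun ξ P)
    (hident : ∀ i, IdentDistrib (ξ i) (ξ 0) P P)  (hL2 : MemLp (ξ 0) 2 P)
    (hmean : ∫ ω, ξ 0 ω ∂P = a) (hvar : variance (ξ 0) P = σ ^ 2)
    (N M : Ω → ℕ) (hN : Measurable N) (hM : Measurable M) (r s : ℝ) (hr : 0 < r) (hrs : r ≤ s)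
    (hlaw : P.map N = poissonMeasure r.toNNReal) (hNM : IndepFun N M P)
    (hξ : IndepFun (fun ω => fun i => ξ i ω) (fun ω => (N ω, M ω)) P)
    (G : ℝ → ℝ) (B : ℝ) (hB : ∀ x, |G x| ≤ B) (L : ℝ≥0) (hL : LipschitzWith L G) :
    |∫ ω, G ((∑ i ∈ Finset.range (N ω), ξ i ω - a * r) / √r) *
        G ((∑ i ∈ Finset.range (N ω + M ω), ξ i ω - a * s) / √s) ∂P -
      (∫ ω, G ((∑ i ∈ Finset.range (N ω), ξ i ω - a * r) / √r) ∂P) *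
        ∫ ω, G ((∑ i ∈ Finset.range (N ω + M ω), ξ i ω - a * s) / √s) ∂P| ≤
      2 * B * L * √(σ ^ 2 + a ^ 2 + 1) * (√r / √s) := by
  have hs : 0 < s := hr.trans_le hrs
  have hB0 : 0 ≤ B := (abs_nonneg _).trans (hB 0)
  have hGm : Measurable G := hL.continuous.measurable
  have hXi : Measurable fun ω => fun i => ξ i ω := measurable_pi_lambda _ hmeas
  have hS : ∀ K : Ω → ℕ, Measurable K → Measurable fun ω => ∑ i ∈ Finset.range (K ω), ξ i ω :=
    fun K hK => aux_meas_sum.comp (hXi.prodMk hK)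
  obtain ⟨hZi, hZ⟩ := aux_first P ξ a σ hmeas hindep hident hL2 hmean hvar N hN r hr hlaw
    (hξ.comp measurable_id measurable_fst)
  have hsplit : ∀ ω, ∑ i ∈ Finset.range (N ω + M ω), ξ i ω = 
      ∑ i ∈ Finset.range (N ω), ξ i ω + ∑ i ∈ Finset.range (M ω), ξ (N ω + i) ω := fun ω => 
    Finset.sum_range_add _ _ _
  have hSW : Measurable fun ω => ∑ i ∈ Finset.range (M ω), ξ (N ω + i) ω := by
    have : (fun ω => ∑ i ∈ Finset.range (M ω), ξ (N ω + i) ω) = fun ω => 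
      ∑ i ∈ Finset.range (N ω + M ω), ξ i ω - ∑ i ∈ Finset.range (N ω), ξ i ω := by
      ext ω; rw [hsplit]; ring
    rw [this]
    exact (hS _ (hN.add hM)).sub (hS _ hN)
  set U : Ω → ℝ := fun ω => G ((∑ i ∈ Finset.range (N ω), ξ i ω - a * r) / √r) with hU
  set V : Ω → ℝ := fun ω => G ((∑ i ∈ Finset.range (N ω + M ω), ξ i ω - a * s) / √s) with hV
  set W : Ω → ℝ := fun ω => G ((∑ i ∈ Finset.range (M ω), ξ (N ω + i) ω - a * (s - r)) / √s) with hW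
  have hUm : Measurable U := hGm.comp (((hS _ hN).sub_const _).div_const _)
  have hVm : Measurable V := hGm.comp (((hS _ (hN.add hM)).sub_const _).div_const _)
  have hWm : Measurable W := hGm.comp ((hSW.sub_const _).div_const _)
  have hbi : ∀ u : Ω → ℝ, Measurable u → ∀ C : ℝ, (∀ ω, |u ω| ≤ C) → Integrable u P := fun u hu C hC =>
    Integrable.of_bound hu.aestronglyMeasurable C (Eventually.of_forall hC)
  have hUi := hbi U hUm B fun ω => hB _
  have hVi := hbi V hVm B fun ω => hB _
  have hWi := hbi W hWm B fun ω => hB _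
  have hUV : Integrable (fun ω => U ω * V ω) P := hbi _ (hUm.mul hVm) (B * B) fun ω => by
    rw [abs_mul]; exact mul_le_mul (hB _) (hB _) (abs_nonneg _) hB0
  have hUW : Integrable (fun ω => U ω * W ω) P := hbi _ (hUm.mul hWm) (B * B) fun ω => by
    rw [abs_mul]; exact mul_le_mul (hB _) (hB _) (abs_nonneg _) hB0
  have hfac : ∫ ω, U ω * W ω ∂P = (∫ ω, U ω ∂P) * ∫ ω, W ω ∂P :=
    aux_c6 P ξ hmeas hindep hident N M hN hM hNM hξ (fun x => G ((x - a * r) / √r))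
      (fun x => G ((x - a * (s - r)) / √s)) (hGm.comp (by fun_prop)) (hGm.comp (by fun_prop)) B
      (fun x => hB _) (fun x => hB _)
  have hd : ∀ ω, |V ω - W ω| ≤ L / √s * |∑ i ∈ Finset.range (N ω), ξ i ω - a * r| := by
    intro ω
    have := hL.dist_le_mul ((∑ i ∈ Finset.range (N ω + M ω), ξ i ω - a * s) / √s)
      ((∑ i ∈ Finset.range (M ω), ξ (N ω + i) ω - a * (s - r)) / √s)
    rw [Real.dist_eq, Real.dist_eq, hsplit] at this
    have e : (∑ i ∈ Finset.range (N ω), ξ i ω + ∑ i ∈ Finset.range (M ω), ξ (N ω + i) ω - a * s) / √s -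
      (∑ i ∈ Finset.range (M ω), ξ (N ω + i) ω - a * (s - r)) / √s = (∑ i ∈ Finset.range (N ω), ξ i ω - a * r) / √s := by
      ring
    rw [e, abs_div, abs_of_nonneg (Real.sqrt_nonneg s)] at this
    simp only [hV, hW, hsplit]
    refine this.trans (le_of_eq ?_)
    ring
  have hVW : ∫ ω, |V ω - W ω| ∂P ≤ L / √s * (√(σ ^ 2 + a ^ 2 + 1) * √r) := by
    calc ∫ ω, |V ω - W ω| ∂P ≤ ∫ ω, L / √s * |∑ i ∈ Finset.range (N ω), ξ i ω - a * r| ∂P :=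
          integral_mono (hVi.sub hWi).abs (hZi.abs.const_mul _) hd
      _ = L / √s * ∫ ω, |∑ i ∈ Finset.range (N ω), ξ i ω - a * r| ∂P := integral_const_mul _ _
      _ ≤ _ := by gcongr
  have h1 : |∫ ω, U ω * V ω ∂P - ∫ ω, U ω * W ω ∂P| ≤ B * ∫ ω, |V ω - W ω| ∂P := by
    rw [← integral_sub hUV hUW, ← integral_const_mul]
    refine abs_integral_le_integral_abs.trans (integral_mono (hUV.sub hUW).abs ((hVi.sub hWi).abs.const_mul _) fun ω => ?_)
    simp only
    rw [← mul_sub, abs_mul]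
    gcongr
    exact hB _
  have h2 : |∫ ω, W ω ∂P - ∫ ω, V ω ∂P| ≤ ∫ ω, |V ω - W ω| ∂P := by
    rw [abs_sub_comm, ← integral_sub hVi hWi]
    exact abs_integral_le_integral_abs
  have h3 : |∫ ω, U ω ∂P| ≤ B := by
    have := norm_integral_le_of_norm_le_const (μ := P) (f := U) (C := B) (Eventually.of_forall fun ω => hB _)
    simpa using this
  have h4 : ∫ ω, U ω * V ω ∂P - (∫ ω, U ω ∂P) * ∫ ω, V ω ∂P =
    (∫ ω, U ω * V ω ∂P - ∫ ω, U ω * W ω ∂P) + (∫ ω, U ω ∂P) * (∫ ω, W ω ∂P - ∫ ω, V ω ∂P) := by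
    rw [hfac]; ring
  rw [h4]
  refine (abs_add_le _ _).trans ?_
  rw [abs_mul]
  have h5 : |∫ ω, U ω ∂P| * |∫ ω, W ω ∂P - ∫ ω, V ω ∂P| ≤ B * ∫ ω, |V ω - W ω| ∂P := 
    mul_le_mul h3 h2 (abs_nonneg _) hB0
  have h6 := mul_le_mul_of_nonneg_left hVW hB0
  have h7 : 2 * B * L * √(σ ^ 2 + a ^ 2 + 1) * (√r / √s) = 2 * (B * (L / √s * (√(σ ^ 2 + a ^ 2 + 1) * √r))) := by ring
  rw [h7]
  linarith

lemma aux_cesaro (φ : ℝ → ℝ) (hφ : Measurable φ) (B : ℝ) (hB : ∀ x, |φ x| ≤ B) (l : ℝ)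
    (hl : Tendsto φ atTop (𝓝 l)) :
    Tendsto (fun T : ℝ => (1 / T) * ∫ x in Set.Ioc 0 T, φ x) atTop (𝓝 l) := by
  have h1 : Tendsto (fun T : ℝ => ∫ u in (0:ℝ)..1, φ (T * u)) atTop (𝓝 (∫ u in (0:ℝ)..1, l)) := by
    refine intervalIntegral.tendsto_integral_filter_of_dominated_convergence (fun _ => B) ?_ ?_ ?_ ?_
    · exact Eventually.of_forall fun T => (hφ.comp (measurable_const_mul T)).aestronglyMeasurable
    · exact Eventually.of_forall fun T => Eventually.of_forall fun u _ => hB _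
    · exact intervalIntegrable_const
    · refine Eventually.of_forall fun u hu => hl.comp ?_
      rw [Set.uIoc_of_le zero_le_one] at hu
      exact tendsto_id.atTop_mul_const hu.1
  simp only [intervalIntegral.integral_const, sub_zero, one_smul] at h1
  refine h1.congr' ?_
  filter_upwards [eventually_gt_atTop 0] with T hT
  rw [intervalIntegral.integral_comp_mul_left _ hT.ne', mul_zero, mul_one, intervalIntegral.integral_of_le hT.le]
  simp

lemma aux_main {Ω : Type*} [MeasurableSpace Ω] (P : Measure Ω) [IsProbabilityMeasure P]
    (ξ : ℕ → Ω → ℝ) (a σ : ℝ)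
    (hmeas : ∀ i, Measurable (ξ i))
    (hindep : iIndepFun ξ P)
    (hident : ∀ i, IdentDistrib (ξ i) (ξ 0) P P)
    (hL2 : MemLp (ξ 0) 2 P)
    (hmean : ∫ ω, ξ 0 ω ∂P = a)
    (hvar : variance (ξ 0) P = σ ^ 2)
    (π : ℝ → Ω → ℕ)
    (hπmeas : ∀ t, Measurable (π t))
    (hπ0 : ∀ᵐ ω ∂P, π 0 ω = 0)
    (hπindep : ∀ (k : ℕ) (t : Fin (k + 1) → ℝ), Monotone t → 0 ≤ t 0 →
      iIndepFun
        (fun i : Fin k => fun ω => (π (t i.succ) ω : ℝ) - (π (t i.castSucc) ω : ℝ)) P)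
    (hπdist : ∀ s t : ℝ, 0 ≤ s → s < t →
      Measure.map (fun ω => (π t ω : ℝ) - (π s ω : ℝ)) P
        = Measure.map (fun n : ℕ => (n : ℝ)) (poissonMeasure (t - s).toNNReal))
    (hπjoint : Measurable (Function.uncurry fun (s : ℝ) (ω : Ω) => π s ω))
    (hπξ : IndepFun (fun ω => fun i : ℕ => ξ i ω) (fun ω => fun t : ℝ => π t ω) P)
    (F : ℝ → ℝ) (hF : Monotone F) (hF0 : ∀ x, 0 < F x) (hFt : Tendsto F atTop atTop)
    (γ : ℝ) (hγ : 0 < γ) (hFγ : ∀ x y, 0 ≤ x → x ≤ y → √(F x) / √(F y) ≤ Real.exp (-γ * (y - x)))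
    (G : ℝ → ℝ) (B : ℝ) (hB : ∀ x, |G x| ≤ B) (L : ℝ≥0) (hL : LipschitzWith L G) :
    ∀ᵐ ω ∂P, Tendsto (fun T : ℝ => (1 / T) * ∫ x in Set.Ioc 0 T,
      G ((∑ i ∈ Finset.range (π (F x) ω), ξ i ω - a * F x) / √(F x))) atTop
        (𝓝 (∫ y, G y ∂(gaussianReal 0 (σ ^ 2 + a ^ 2).toNNReal))) := by
  have hB0 : 0 ≤ B := (abs_nonneg _).trans (hB 0)
  have hGm : Measurable G := hL.continuous.measurable
  have hXi : Measurable fun ω => fun i => ξ i ω := measurable_pi_lambda _ hmeas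
  have hlaw := aux_law P π hπmeas hπ0 hπdist
  have hξr : ∀ r, IndepFun (fun ω => fun i => ξ i ω) (π r) P := fun r =>
    hπξ.comp measurable_id (measurable_pi_apply r)
  have hFm : Measurable F := hF.measurable
  set V : ℝ → Ω → ℝ := fun x ω => G ((∑ i ∈ Finset.range (π (F x) ω), ξ i ω - a * F x) / √(F x)) with hV
  have hVm : Measurable (Function.uncurry V) := by
    have h1 : Measurable fun p : ℝ × Ω => π (F p.1) p.2 :=
      hπjoint.comp ((hFm.comp measurable_fst).prodMk measurable_snd)
    have h2 : Measurable fun p : ℝ × Ω => ∑ i ∈ Finset.range (π (F p.1) p.2), ξ i p.2 :=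
      aux_meas_sum.comp ((hXi.comp measurable_snd).prodMk h1)
    have h3 : Measurable fun p : ℝ × Ω => F p.1 := hFm.comp measurable_fst
    exact hGm.comp ((h2.sub (h3.const_mul a)).div h3.sqrt)
  have hVx : ∀ x, Measurable (V x) := fun x => hVm.comp measurable_prodMk_left
  have hVω : ∀ ω, Measurable fun x => V x ω := fun ω => hVm.comp measurable_prodMk_right
  have hVB : ∀ x ω, |V x ω| ≤ B := fun x ω => hB _
  have hVi : ∀ x, Integrable (V x) P := fun x =>
    Integrable.of_bound (hVx x).aestronglyMeasurable B (Eventually.of_forall (hVB x))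
  set m : ℝ → ℝ := fun x => ∫ ω, V x ω ∂P with hm
  have hmm : Measurable m := (hVm.stronglyMeasurable.integral_prod_right).measurable
  have hmB : ∀ x, |m x| ≤ B := by
    intro x
    have := norm_integral_le_of_norm_le_const (μ := P) (f := V x) (C := B) (Eventually.of_forall fun ω => hB _)
    simpa using this
  have herg := aux_ergodic P (fun x ω => V x ω - m x) (hVm.sub (hmm.comp measurable_fst)) (B + B)
    (fun x ω => (abs_sub _ _).trans (add_le_add (hVB _ _) (hmB _))) (2 * B * L * √(σ ^ 2 + a ^ 2 + 1)) γ (by positivity) hγ ?_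
  · have hmt : Tendsto m atTop (𝓝 (∫ y, G y ∂(gaussianReal 0 (σ ^ 2 + a ^ 2).toNNReal))) := by
      have := aux_clt P ξ a σ hmeas hindep hident hL2 hmean hvar π hπmeas hlaw hξr
        (BoundedContinuousFunction.ofNormedAddCommGroup G hL.continuous B hB)
      exact this.comp hFt
    have hces := aux_cesaro m hmm B hmB _ hmt
    filter_upwards [herg] with ω hω
    have h := hω.add hces
    rw [zero_add] at h
    refine h.congr fun T => ?_
    have hfi : ∀ φ : ℝ → ℝ, Measurable φ → (∀ x, |φ x| ≤ B) → IntegrableOn φ (Set.Ioc 0 T) := fun φ h1 h2 =>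
      Integrable.of_bound h1.aestronglyMeasurable B (Eventually.of_forall h2)
    rw [integral_sub (hfi _ (hVω ω) fun x => hVB x ω) (hfi _ hmm hmB)]
    ring
  · intro x y hx hxy
    have hFxy := hF hxy
    set N := π (F x) with hN
    set M : Ω → ℕ := fun ω => π (F y) ω - π (F x) ω with hM
    have hMm : Measurable M := (hπmeas _).sub (hπmeas _)
    have hpair : IndepFun (fun ω => fun i => ξ i ω) (fun ω => (N ω, M ω)) P :=
      hπξ.comp (ψ := fun p : ℝ → ℕ => (p (F x), p (F y) - p (F x))) measurable_id
        ((measurable_pi_apply _).prodMk ((measurable_pi_apply _).sub (measurable_pi_apply _)))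
    have hc := aux_cov P ξ a σ hmeas hindep hident hL2 hmean hvar N M (hπmeas _) hMm (F x) (F y) (hF0 x) hFxy
      (hlaw _ (hF0 x)) (aux_NM_indep P π hπ0 hπindep _ _ (hF0 x).le hFxy) hpair G B hB L hL
    have hmono := aux_mono P π hπmeas hπdist _ _ (hF0 x).le hFxy
    have e1 : ∫ ω, G ((∑ i ∈ Finset.range (N ω), ξ i ω - a * F x) / √(F x)) *
        G ((∑ i ∈ Finset.range (N ω + M ω), ξ i ω - a * F y) / √(F y)) ∂P = ∫ ω, V x ω * V y ω ∂P := by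
      refine integral_congr_ae ?_
      filter_upwards [hmono] with ω hω
      simp only [hV, hN, hM, Nat.add_sub_cancel' hω]
    have e2 : ∫ ω, G ((∑ i ∈ Finset.range (N ω + M ω), ξ i ω - a * F y) / √(F y)) ∂P = m y := by
      refine integral_congr_ae ?_
      filter_upwards [hmono] with ω hω
      simp only [hV, hN, hM, Nat.add_sub_cancel' hω]
    rw [e1, e2] at hc
    have hVV : Integrable (fun ω => V x ω * V y ω) P :=
      Integrable.of_bound ((hVx x).mul (hVx y)).aestronglyMeasurable (B * B) (Eventually.of_forall fun ω => by
        rw [Real.norm_eq_abs, abs_mul]; exact mul_le_mul (hVB _ _) (hVB _ _) (abs_nonneg _) hB0)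
    have e3 : ∫ ω, (V x ω - m x) * (V y ω - m y) ∂P = ∫ ω, V x ω * V y ω ∂P - m x * m y := by
      have : ∀ ω, (V x ω - m x) * (V y ω - m y) = V x ω * V y ω - m x * V y ω - m y * V x ω + m x * m y := fun ω => by ring
      simp_rw [this]
      have i1 : Integrable (fun ω => V x ω * V y ω - m x * V y ω) P := hVV.sub ((hVi y).const_mul _)
      have i2 : Integrable (fun ω => V x ω * V y ω - m x * V y ω - m y * V x ω) P := i1.sub ((hVi x).const_mul _)
      rw [integral_add i2 (integrable_const _), integral_sub i1 ((hVi x).const_mul _),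
        integral_sub hVV ((hVi y).const_mul _), integral_const_mul, integral_const_mul]
      simp only [integral_const, probReal_univ, one_smul]
      simp only [hm]
      ring
    rw [e3]
    refine hc.trans ?_
    gcongr
    exact hFγ x y hx hxy

lemma aux_subst (h : ℝ → ℝ) (S : ℝ) (hS : 1 ≤ S) :
    ∫ s in (1:ℝ)..S, h s * (1 / s) = ∫ x in Set.Ioc 0 (Real.log S), h (Real.exp x) := by
  have himg : Real.exp '' Set.Ioc 0 (Real.log S) = Set.Ioc 1 S := by
    ext s
    constructor
    · rintro ⟨x, hx, rfl⟩
      exact ⟨Real.one_lt_exp_iff.2 hx.1, (Real.le_log_iff_exp_le (by linarith)).1 hx.2⟩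
    · intro hs
      refine ⟨Real.log s, ⟨Real.log_pos hs.1, Real.log_le_log (by linarith [hs.1]) hs.2⟩, Real.exp_log (by linarith [hs.1])⟩
  rw [intervalIntegral.integral_of_le hS, ← himg,
    integral_image_eq_integral_abs_deriv_smul measurableSet_Ioc
      (fun x _ => (Real.hasDerivAt_exp x).hasDerivWithinAt) Real.exp_injective.injOn]
  refine integral_congr_ae (Eventually.of_forall fun x => ?_)
  simp only [smul_eq_mul, abs_of_pos (Real.exp_pos x)]
  have := (Real.exp_pos x).ne'
  field_simp

lemma aux_final (X : ℝ → ℝ) (hX : Measurable X) (ν0 : Measure ℝ) [IsProbabilityMeasure ν0]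
    (h : ∀ K n : ℕ, Tendsto (fun T : ℝ => (1 / T) * ∫ x in Set.Ioc 0 T, auxH K n (X x)) atTop
        (𝓝 (∫ y, auxH K n y ∂ν0))) (g : BoundedContinuousFunction ℝ ℝ) :
    Tendsto (fun T : ℝ => (1 / T) * ∫ x in Set.Ioc 0 T, g (X x)) atTop (𝓝 (∫ y, g y ∂ν0)) := by
  let ν : ℝ → Measure ℝ := fun T =>
    ((ENNReal.ofReal (max T 1))⁻¹ • volume.restrict (Set.Ioc 0 (max T 1))).map X
  have hν : ∀ T, IsProbabilityMeasure (ν T) := by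
    intro T
    have hp : (0:ℝ) < max T 1 := lt_max_of_lt_right one_pos
    have : IsProbabilityMeasure ((ENNReal.ofReal (max T 1))⁻¹ • volume.restrict (Set.Ioc 0 (max T 1))) := by
      constructor
      simp only [Measure.smul_apply, Measure.restrict_apply_univ, Real.volume_Ioc, sub_zero, smul_eq_mul]
      exact ENNReal.inv_mul_cancel (by simp) (by simp)
    exact Measure.isProbabilityMeasure_map hX.aemeasurable
  have hint : ∀ φ : ℝ → ℝ, Continuous φ → ∀ᶠ T in atTop, (1 / T) * ∫ x in Set.Ioc 0 T, φ (X x) = ∫ y, φ y ∂(ν T) := by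
    intro φ hφ
    filter_upwards [eventually_ge_atTop 1] with T hT
    simp only [ν]
    rw [integral_map hX.aemeasurable hφ.aestronglyMeasurable, integral_smul_measure, max_eq_left hT,
      ENNReal.toReal_inv, ENNReal.toReal_ofReal (by linarith), smul_eq_mul, one_div]
  refine (aux_weak ν ν0 (fun K n => (h K n).congr' (hint _ (auxH_contDiff K n).continuous)) g).congr' ?_
  filter_upwards [hint g g.continuous] with T hT
  exact hT.symm

/-- **One-dimensional marginal form of Corollary 3.**
Let `(ξᵢ)` be i.i.d. square-integrable with mean `a` and variance `σ²`, let `π` be a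
Poisson process of intensity 1 independent of `(ξᵢ)`, and let `f` satisfy condition (B).
Then almost surely
`(1/log S) ∫_1^S g ((∑_{i<π(f(s))} ξᵢ - a f(s))/√f(s)) (1/s) ds → ∫ g dN(0, σ² + a²)`
for every bounded continuous `g`. -/
theorem stmt12
    {Ω : Type*} [MeasurableSpace Ω] (P : Measure Ω) [IsProbabilityMeasure P]
    (ξ : ℕ → Ω → ℝ) (a σ : ℝ)
    (hmeas : ∀ i, Measurable (ξ i))
    (hindep : iIndepFun ξ P)
    (hident : ∀ i, IdentDistrib (ξ i) (ξ 0) P P)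
    (hL2 : MemLp (ξ 0) 2 P)
    (hmean : ∫ ω, ξ 0 ω ∂P = a)
    (hvar : variance (ξ 0) P = σ ^ 2)
    (π : ℝ → Ω → ℕ)
    (hπmeas : ∀ t, Measurable (π t))
    (hπ0 : ∀ᵐ ω ∂P, π 0 ω = 0)
    (hπindep : ∀ (k : ℕ) (t : Fin (k + 1) → ℝ), Monotone t → 0 ≤ t 0 →
      iIndepFun
        (fun i : Fin k => fun ω => (π (t i.succ) ω : ℝ) - (π (t i.castSucc) ω : ℝ)) P)
    (hπdist : ∀ s t : ℝ, 0 ≤ s → s < t →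
      Measure.map (fun ω => (π t ω : ℝ) - (π s ω : ℝ)) P
        = Measure.map (fun n : ℕ => (n : ℝ)) (poissonMeasure (t - s).toNNReal))
    (hπjoint : Measurable (Function.uncurry fun (s : ℝ) (ω : Ω) => π s ω))
    (hπξ : IndepFun (fun ω => fun i : ℕ => ξ i ω) (fun ω => fun t : ℝ => π t ω) P)
    (f : ℝ → ℝ) (hf_pos : ∀ x, 1 ≤ x → 0 < f x)
    (β : ℝ) (hβ : 0 < β)
    (hB : ∀ x y : ℝ, 1 ≤ x → x ≤ y → f x / x ^ β ≤ f y / y ^ β) :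
    ∀ᵐ ω ∂P, ∀ g : BoundedContinuousFunction ℝ ℝ,
      Tendsto (fun S : ℝ =>
          (1 / Real.log S) *
            ∫ s in (1 : ℝ)..S,
              g ((∑ i ∈ Finset.range (π (f s) ω), ξ i ω - a * f s) / Real.sqrt (f s))
                * (1 / s)) atTop
        (𝓝 (∫ y, g y ∂(gaussianReal 0 (σ ^ 2 + a ^ 2).toNNReal))) := by
  have hrat : ∀ x y : ℝ, 0 ≤ x → x ≤ y → f (Real.exp x) ≤ Real.exp (-β * (y - x)) * f (Real.exp y) := by
    intro x y hx hxy
    have h := hB (Real.exp x) (Real.exp y) (Real.one_le_exp hx) (Real.exp_le_exp.2 hxy)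
    rw [← Real.exp_mul, ← Real.exp_mul, div_eq_mul_inv, div_eq_mul_inv, ← Real.exp_neg, ← Real.exp_neg] at h
    have h2 := mul_le_mul_of_nonneg_right h (Real.exp_pos (x * β)).le
    rw [mul_assoc, mul_assoc, ← Real.exp_add, ← Real.exp_add] at h2
    simp only [neg_add_cancel, Real.exp_zero, mul_one] at h2
    refine h2.trans (le_of_eq ?_)
    rw [mul_comm]
    congr 2
    ring
  have hpos : ∀ x : ℝ, 0 ≤ x → 0 < f (Real.exp x) := fun x hx => hf_pos _ (Real.one_le_exp hx)
  have hle : ∀ x y : ℝ, 0 ≤ x → x ≤ y → f (Real.exp x) ≤ f (Real.exp y) := by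
    intro x y hx hxy
    refine (hrat x y hx hxy).trans (mul_le_of_le_one_left (hpos y (hx.trans hxy)).le (Real.exp_le_one_iff.2 ?_))
    have : 0 ≤ β * (y - x) := mul_nonneg hβ.le (sub_nonneg.2 hxy)
    linarith
  set F : ℝ → ℝ := fun x => f (Real.exp (max x 0)) with hF
  have hFx : ∀ x, 0 ≤ x → F x = f (Real.exp x) := fun x hx => by simp only [hF, max_eq_left hx]
  have hFmono : Monotone F := fun x y hxy => hle _ _ (le_max_right _ _) (max_le_max_right _ hxy)
  have hF0 : ∀ x, 0 < F x := fun x => hpos _ (le_max_right _ _)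
  have hFt : Tendsto F atTop atTop := by
    have h1 : Tendsto (fun x : ℝ => f (Real.exp 0) * Real.exp (β * x)) atTop atTop :=
      (Real.tendsto_exp_atTop.comp (tendsto_id.const_mul_atTop hβ)).const_mul_atTop (hpos 0 le_rfl)
    refine tendsto_atTop_mono' _ ?_ h1
    filter_upwards [eventually_ge_atTop 0] with x hx
    rw [hFx x hx]
    have h2 := mul_le_mul_of_nonneg_right (hrat 0 x le_rfl hx) (Real.exp_pos (β * x)).le
    refine h2.trans (le_of_eq ?_)
    rw [mul_right_comm, ← Real.exp_add]
    simp
  have hFγ : ∀ x y, 0 ≤ x → x ≤ y → √(F x) / √(F y) ≤ Real.exp (-(β / 2) * (y - x)) := by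
    intro x y hx hxy
    rw [div_le_iff₀ (Real.sqrt_pos.2 (hF0 y)), hFx x hx, hFx y (hx.trans hxy)]
    refine (Real.sqrt_le_sqrt (hrat x y hx hxy)).trans (le_of_eq ?_)
    rw [Real.sqrt_mul (Real.exp_pos _).le, ← Real.exp_half]
    congr 2
    ring
  have hXi : Measurable fun ω => fun i => ξ i ω := measurable_pi_lambda _ hmeas
  have hall : ∀ᵐ ω ∂P, ∀ K n : ℕ, Tendsto (fun T : ℝ => (1 / T) * ∫ x in Set.Ioc 0 T,
      auxH K n ((∑ i ∈ Finset.range (π (F x) ω), ξ i ω - a * F x) / √(F x))) atTop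
        (𝓝 (∫ y, auxH K n y ∂(gaussianReal 0 (σ ^ 2 + a ^ 2).toNNReal))) := by
    rw [ae_all_iff]; intro K
    rw [ae_all_iff]; intro n
    obtain ⟨L, hL⟩ := auxH_lip K n
    obtain ⟨B, hBd⟩ := auxH_bdd K n
    exact aux_main P ξ a σ hmeas hindep hident hL2 hmean hvar π hπmeas hπ0 hπindep hπdist hπjoint hπξ
      F hFmono hF0 hFt (β / 2) (by positivity) hFγ (auxH K n) B hBd L hL
  filter_upwards [hall] with ω hω
  intro g
  have hXω : Measurable fun x => (∑ i ∈ Finset.range (π (F x) ω), ξ i ω - a * F x) / √(F x) := by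
    have hFm : Measurable F := hFmono.measurable
    have h1 : Measurable fun x => π (F x) ω := hπjoint.comp (hFm.prodMk measurable_const)
    have h2 : Measurable fun x => ∑ i ∈ Finset.range (π (F x) ω), ξ i ω :=
      (measurable_from_top (f := fun n : ℕ => ∑ i ∈ Finset.range n, ξ i ω)).comp h1
    exact (h2.sub (hFm.const_mul a)).div hFm.sqrt
  have hfin := (aux_final _ hXω _ hω g).comp Real.tendsto_log_atTop
  refine hfin.congr' ?_
  filter_upwards [eventually_ge_atTop 1] with S hS
  simp only [Function.comp]
  rw [aux_subst (fun s => g ((∑ i ∈ Finset.range (π (f s) ω), ξ i ω - a * f s) / √(f s))) S hS]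
  congr 1
  refine setIntegral_congr_fun measurableSet_Ioc fun x hx => ?_
  simp only [hFx x hx.1.le]
end

section
/- Let π be a Poisson process of intensity 1 with (s, ω) ↦ π(s, ω) jointly measurable. Assume f : [1,∞) → (0,∞) satisfies condition (B): for some β > 0 the function x ↦ f(x)/x^β is increasing; assume d : [1,∞) → (0,∞) satisfies condition (C): d is decreasing, ∫_k^{k+1} d(s) ds ≤ log √((k+1)/k) for all k ∈ ℕ, and ∫_1^∞ d(s) ds = +∞; set D(S) = ∫_1^S d(s) ds. Then for almost every ω ∈ Ω, for every bounded continuous function g : ℝ → ℝ, one has (1/D(S)) ∫_1^S g((π(f(s), ω) − f(s))/√f(s))·d(s) ds → ∫ g dN(0, 1) as S → ∞. (One-dimensional marginal form of Corollary 5.) -/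
open MeasureTheory ProbabilityTheory Filter Topology NNReal

lemma pois_h1 (r : ℝ) : HasSum (fun n : ℕ => r ^ n / (n.factorial : ℝ) * n) (Real.exp r * r) := by
  have h0 : HasSum (fun n : ℕ => r ^ n / (n.factorial : ℝ)) (Real.exp r) := by
    rw [Real.exp_eq_exp_ℝ]; exact NormedSpace.expSeries_div_hasSum_exp r
  have := h0.mul_right r
  rw [← hasSum_nat_add_iff' 1]
  simp only [Finset.range_one, Finset.sum_singleton, Nat.cast_zero, mul_zero, sub_zero]
  refine this.congr_fun ?_ |> fun h => h
  intro n
  rw [Nat.factorial_succ]; push_cast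
  field_simp
  rw [pow_succ]

lemma pois_h2 (r : ℝ) : HasSum (fun n : ℕ => r ^ n / (n.factorial : ℝ) * n * n)
    (Real.exp r * r * r + Real.exp r * r) := by
  have h1 := pois_h1 r
  have h0 : HasSum (fun n : ℕ => r ^ n / (n.factorial : ℝ)) (Real.exp r) := by
    rw [Real.exp_eq_exp_ℝ]; exact NormedSpace.expSeries_div_hasSum_exp r
  have := (h1.mul_right r).add (h0.mul_right r)
  rw [← hasSum_nat_add_iff' 1]
  simp only [Finset.range_one, Finset.sum_singleton, Nat.cast_zero, mul_zero, sub_zero]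
  refine this.congr_fun ?_ |> fun h => h
  intro n
  rw [Nat.factorial_succ]; push_cast
  field_simp
  rw [pow_succ]

lemma pois_sq (r : ℝ≥0) : HasSum (fun n : ℕ => Real.exp (-r) * r ^ n / (n.factorial : ℝ) * ((n:ℝ) - r)^2) r := by
  have h0 : HasSum (fun n : ℕ => (r:ℝ) ^ n / (n.factorial : ℝ)) (Real.exp r) := by
    rw [Real.exp_eq_exp_ℝ]; exact NormedSpace.expSeries_div_hasSum_exp (r:ℝ)
  have h := (((pois_h2 r).sub ((pois_h1 r).mul_right (2*(r:ℝ)))).add (h0.mul_right ((r:ℝ)^2))).mul_left (Real.exp (-r))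
  have this : Real.exp (-(r:ℝ)) * Real.exp r = 1 := by rw [← Real.exp_add]; simp
  have e : ∀ a b c : ℝ, a * b = 1 → a * (b * c * c + b * c - b * c * (2 * c) + b * c ^ 2) = c := by
    intro a b c h
    linear_combination c * h
  rw [e _ _ _ this] at h
  refine h.congr_fun fun n => ?_
  ring

lemma pois_abs (r : ℝ≥0) (hr : 0 < r) :
    Integrable (fun x : ℝ => |x - r|) (Measure.map (fun n : ℕ => (n : ℝ)) (poissonMeasure r)) ∧
    ∫ x, |x - r| ∂(Measure.map (fun n : ℕ => (n : ℝ)) (poissonMeasure r)) ≤ Real.sqrt r := by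
  have hs : Integrable (fun n : ℕ => ((n:ℝ) - r)^2) (poissonMeasure r) := by
    rw [integrable_poissonMeasure_iff]
    refine (pois_sq r).summable.congr fun n => ?_
    rw [Real.norm_of_nonneg (sq_nonneg _)]
  have hI : ∫ n : ℕ, ((n:ℝ) - r)^2 ∂(poissonMeasure r) = r := by
    rw [integral_poissonMeasure' hs]
    simpa using (pois_sq r).tsum_eq
  have hr' : (0:ℝ) < Real.sqrt r := Real.sqrt_pos.2 hr
  have hb : ∀ n : ℕ, |(n:ℝ) - r| ≤ (((n:ℝ) - r)^2 / Real.sqrt r + Real.sqrt r) / 2 := by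
    intro n
    rw [le_div_iff₀ (by norm_num), div_add' _ _ _ hr'.ne', le_div_iff₀ hr', ← sq_abs ((n:ℝ) - r)]
    nlinarith [sq_nonneg (|(n:ℝ) - r| - Real.sqrt r)]
  have hint : Integrable (fun n : ℕ => (((n:ℝ) - r)^2 / Real.sqrt r + Real.sqrt r) / 2) (poissonMeasure r) :=
    ((hs.div_const _).add (integrable_const _)).div_const _
  have hm : Integrable (fun n : ℕ => |(n:ℝ) - r|) (poissonMeasure r) := by
    refine hint.mono' (by fun_prop) (Eventually.of_forall fun n => ?_)
    simpa using hb n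
  constructor
  · rw [integrable_map_measure (by fun_prop) (by fun_prop)]
    exact hm
  · rw [integral_map (by fun_prop) (by fun_prop)]
    refine (integral_mono hm hint hb).trans ?_
    rw [integral_div, integral_add (hs.div_const _) (integrable_const _), integral_div, hI]
    simp [Real.div_sqrt]

/-- char fun asymptotics -/
lemma pois_exp_lim (u : ℝ) : Tendsto (fun l : ℝ => (l:ℂ) * (Complex.exp ((u / Real.sqrt l : ℝ) * Complex.I) - 1)
    - (u * Real.sqrt l : ℝ) * Complex.I) atTop (𝓝 (-(u:ℂ)^2/2)) := by
  rw [tendsto_iff_norm_sub_tendsto_zero]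
  have hlim : Tendsto (fun l : ℝ => |u|^3 * Real.exp |u| * (Real.sqrt l)⁻¹) atTop (𝓝 0) := by
    have := (tendsto_inv_atTop_zero.comp Real.tendsto_sqrt_atTop).const_mul (|u|^3 * Real.exp |u|)
    simpa using this
  refine squeeze_zero' (Eventually.of_forall fun _ => norm_nonneg _) ?_ hlim
  filter_upwards [eventually_ge_atTop 1] with l hl
  have hs : 1 ≤ Real.sqrt l := Real.one_le_sqrt.2 hl
  have hs0 : 0 < Real.sqrt l := by linarith
  set q := Real.sqrt l with hq
  have hl2 : l = q^2 := (Real.sq_sqrt (by linarith)).symm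
  have hb := Complex.norm_exp_sub_sum_le_norm_mul_exp (((u / q : ℝ):ℂ) * Complex.I) 3
  have hqc : (q:ℂ) ≠ 0 := by exact_mod_cast hs0.ne'
  have e : ((l:ℂ) * (Complex.exp ((u / q : ℝ) * Complex.I) - 1)
    - (u * q : ℝ) * Complex.I) - (-(u:ℂ)^2/2) = (q:ℂ)^2 * (Complex.exp (((u / q : ℝ):ℂ) * Complex.I) - ∑ m ∈ Finset.range 3, (((u / q : ℝ):ℂ) * Complex.I) ^ m / (m.factorial : ℂ)) := by
    simp only [Finset.sum_range_succ, Finset.sum_range_zero, hl2]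
    push_cast
    simp only [mul_pow, Complex.I_sq, Nat.factorial]
    field_simp
    push_cast
    ring
  rw [e, norm_mul]
  have hn : ‖((u / q : ℝ):ℂ) * Complex.I‖ = |u| / q := by
    rw [norm_mul, Complex.norm_I, mul_one, Complex.norm_real, Real.norm_eq_abs, abs_div, abs_of_pos hs0]
  rw [hn] at hb
  have hn2 : ‖(q:ℂ)^2‖ = q^2 := by rw [norm_pow, Complex.norm_real, Real.norm_of_nonneg hs0.le]
  rw [hn2]
  have : Real.exp (|u|/q) ≤ Real.exp |u| := Real.exp_le_exp.2 (div_le_self (abs_nonneg _) hs)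
  calc _ ≤ q^2 * ((|u|/q)^3 * Real.exp (|u|/q)) := by gcongr
    _ ≤ q^2 * ((|u|/q)^3 * Real.exp (|u|)) := by gcongr
    _ = _ := by field_simp

lemma pois_clt (g : BoundedContinuousFunction ℝ ℝ) (lam : ℕ → ℝ) (hpos : ∀ n, 0 < lam n)
    (hl : Tendsto lam atTop atTop) :
    Tendsto (fun n => ∫ x, g ((x - lam n) / Real.sqrt (lam n)) ∂(Measure.map (fun n : ℕ => (n : ℝ)) (poissonMeasure (lam n).toNNReal)))
      atTop (𝓝 (∫ y, g y ∂(gaussianReal 0 1))) := by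
  have hp : ∀ n, IsProbabilityMeasure (Measure.map (fun n : ℕ => (n : ℝ)) (poissonMeasure (lam n).toNNReal)) :=
    fun n => Measure.isProbabilityMeasure_map (by fun_prop)
  let ms : ℕ → ProbabilityMeasure ℝ := fun n =>
    ⟨Measure.map (fun x : ℝ => (x - lam n) / Real.sqrt (lam n)) (Measure.map (fun n : ℕ => (n : ℝ)) (poissonMeasure (lam n).toNNReal)),
      Measure.isProbabilityMeasure_map (by fun_prop)⟩
  let m0 : ProbabilityMeasure ℝ := ⟨gaussianReal 0 1, inferInstance⟩
  have key : Tendsto ms atTop (𝓝 m0) := by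
    apply ProbabilityMeasure.tendsto_of_tendsto_charFun
    intro u
    have h1 := ((pois_exp_lim u).comp hl).cexp
    have e0 : charFun (m0 : Measure ℝ) u = Complex.exp (-(u:ℂ)^2/2) := by
      simp only [m0, ProbabilityMeasure.coe_mk, charFun_gaussianReal]
      congr 1; push_cast; ring
    rw [e0]
    refine h1.congr fun n => ?_
    have hq := Real.sqrt_pos.2 (hpos n)
    have hc := charFun_map_cast_poissonMeasure (lam n).toNNReal (u / Real.sqrt (lam n))
    simp only [ms, ProbabilityMeasure.coe_mk, Function.comp]
    rw [Complex.exp_sub]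
    have : ((lam n).toNNReal : ℂ) = ((lam n : ℝ) : ℂ) := by
      norm_cast; simp [(hpos n).le]
    rw [this] at hc
    rw [← hc, charFun_apply, charFun_apply, integral_map (by fun_prop) (by fun_prop), integral_map (by fun_prop) (by fun_prop), integral_map (by fun_prop) (by fun_prop), div_eq_mul_inv, ← Complex.exp_neg, ← integral_mul_const]
    refine integral_congr_ae (.of_forall fun x => ?_)
    simp only
    rw [← Complex.exp_add]
    congr 1
    simp only [Real.inner_apply]
    have hl2 : lam n = Real.sqrt (lam n) ^ 2 := (Real.sq_sqrt (hpos n).le).symm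
    have : (x - lam n) / Real.sqrt (lam n) * u = x * (u / Real.sqrt (lam n)) - u * Real.sqrt (lam n) := by
      field_simp
      linear_combination (- u) * hl2
    rw [this]; push_cast; ring
  rw [ProbabilityMeasure.tendsto_iff_forall_integral_tendsto] at key
  refine (key g).congr fun n => ?_
  simp only [ms, ProbabilityMeasure.coe_mk]
  rw [integral_map (by fun_prop) (by fun_prop)]

lemma lemC {ι : Type*} {L : Filter ι} [L.IsCountablyGenerated] [L.NeBot]
    (μs : ι → ProbabilityMeasure ℝ) (μ : ProbabilityMeasure ℝ)
    (h : ∀ (T : Finset (ℚ × ℚ)) (n : ℕ), Tendsto (fun i => ∫ x,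
        ((thickenedIndicator (δ := (1 : ℝ) / (n + 1)) (by positivity) (⋃ p ∈ T, Set.Ioo (p.1:ℝ) p.2)ᶜ x : ℝ≥0) : ℝ) ∂(μs i : Measure ℝ)) L
      (𝓝 (∫ x, ((thickenedIndicator (δ := (1 : ℝ) / (n + 1)) (by positivity) (⋃ p ∈ T, Set.Ioo (p.1:ℝ) p.2)ᶜ x : ℝ≥0) : ℝ) ∂(μ : Measure ℝ)))) :
    Tendsto μs L (𝓝 μ) := by
  classical
  have core : ∀ (T : Finset (ℚ × ℚ)) (r : ℝ), r < (μ : Measure ℝ).real (⋃ p ∈ T, Set.Ioo (p.1:ℝ) p.2) →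
      ∀ᶠ i in L, r < (μs i : Measure ℝ).real (⋃ p ∈ T, Set.Ioo (p.1:ℝ) p.2) := by
    intro T r hr
    set O := (⋃ p ∈ T, Set.Ioo (p.1:ℝ) p.2) with hO
    have hOo : IsOpen O := isOpen_biUnion fun p _ => isOpen_Ioo
    have key₁ := tendsto_integral_thickenedIndicator_of_isClosed (μ : Measure ℝ) hOo.isClosed_compl (δs := fun n : ℕ ↦ (1 : ℝ) / (n + 1))
      (fun _ ↦ by positivity) tendsto_one_div_add_atTop_nhds_zero_nat
    have hc : (μ : Measure ℝ).real Oᶜ < 1 - r := by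
      rw [probReal_compl_eq_one_sub hOo.measurableSet]; linarith
    obtain ⟨n, hn⟩ := (key₁.eventually_lt_const hc).exists
    filter_upwards [(h T n).eventually_lt_const hn] with i hi
    have : (μs i : Measure ℝ).real Oᶜ ≤ ∫ x, ((thickenedIndicator (δ := (1 : ℝ) / (n + 1)) (by positivity) Oᶜ x : ℝ≥0) : ℝ) ∂(μs i : Measure ℝ) := by
      rw [← integral_indicator_one hOo.measurableSet.compl]
      refine integral_mono ?_ (integrable_thickenedIndicator _ _) ?_
      · exact (integrable_indicator_iff hOo.measurableSet.compl).mpr (integrable_const _).integrableOn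
      · have h : _ ≤ fun x => ((thickenedIndicator (δ := (1 : ℝ) / (n + 1)) (by positivity) Oᶜ x : ℝ≥0) : ℝ) :=
          indicator_le_thickenedIndicator (δ := (1 : ℝ) / (n + 1)) (by positivity) Oᶜ
        simpa using! h
    rw [probReal_compl_eq_one_sub hOo.measurableSet] at this
    linarith
  apply tendsto_of_forall_isOpen_le_liminf
  intro G hG
  refine (le_liminf_iff (isCoboundedUnder_ge_of_le (x := 1) L (by simp)) (by isBoundedDefault)).2
    (fun r hr ↦ ?_)
  obtain ⟨T, TS, T_meas, TG⟩ := μ.exists_lt_measure_biUnion_of_isOpen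
    (S := Set.range fun p : ℚ × ℚ => Set.Ioo (p.1:ℝ) p.2) (by
      intro u hu x hx
      obtain ⟨a, b, hab, hsub⟩ := mem_nhds_iff_exists_Ioo_subset.1 (hu.mem_nhds hx)
      obtain ⟨p, hp1, hp2⟩ := exists_rat_btwn hab.1
      obtain ⟨q, hq1, hq2⟩ := exists_rat_btwn hab.2
      exact ⟨_, ⟨(p,q), rfl⟩, Ioo_mem_nhds hp2 hq1, (Set.Ioo_subset_Ioo hp1.le hq2.le).trans hsub⟩) hG hr
  choose! φ hφ using fun t ht => TS t ht
  have hU : (⋃ t ∈ T, t) = ⋃ p ∈ T.image φ, Set.Ioo (p.1:ℝ) p.2 := by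
    rw [Finset.set_biUnion_finset_image]
    exact Set.iUnion₂_congr fun t ht => (hφ t ht).symm
  rw [hU] at T_meas TG
  filter_upwards [core (T.image φ) r (by simpa [Measure.real] using! T_meas)] with i hi
  have h2 : r < μs i (⋃ p ∈ T.image φ, Set.Ioo (p.1:ℝ) p.2) := by exact_mod_cast hi
  exact h2.trans_le (ProbabilityMeasure.apply_mono _ TG)

lemma pp_law {Ω : Type*} [MeasurableSpace Ω] (P : Measure Ω) [IsProbabilityMeasure P]
    (π : ℝ → Ω → ℕ)
    (hπ0 : ∀ᵐ ω ∂P, π 0 ω = 0)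
    (hπdist : ∀ s t : ℝ, 0 ≤ s → s < t →
      Measure.map (fun ω => (π t ω : ℝ) - (π s ω : ℝ)) P
        = Measure.map (fun n : ℕ => (n : ℝ)) (poissonMeasure (t - s).toNNReal))
    (a : ℝ) (ha : 0 < a) :
    Measure.map (fun ω => (π a ω : ℝ)) P = Measure.map (fun n : ℕ => (n : ℝ)) (poissonMeasure a.toNNReal) := by
  have h := hπdist 0 a le_rfl ha
  rw [sub_zero] at h
  rw [← h]
  refine Measure.map_congr ?_
  filter_upwards [hπ0] with ω hω
  simp [hω]

lemma pp_cov {Ω : Type*} [MeasurableSpace Ω] (P : Measure Ω) [IsProbabilityMeasure P]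
    (π : ℝ → Ω → ℕ)
    (hπmeas : ∀ t, Measurable (π t))
    (hπ0 : ∀ᵐ ω ∂P, π 0 ω = 0)
    (hπindep : ∀ (k : ℕ) (t : Fin (k + 1) → ℝ), Monotone t → 0 ≤ t 0 →
      iIndepFun
        (fun i : Fin k => fun ω => (π (t i.succ) ω : ℝ) - (π (t i.castSucc) ω : ℝ)) P)
    (hπdist : ∀ s t : ℝ, 0 ≤ s → s < t →
      Measure.map (fun ω => (π t ω : ℝ) - (π s ω : ℝ)) P
        = Measure.map (fun n : ℕ => (n : ℝ)) (poissonMeasure (t - s).toNNReal))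
    (g : ℝ → ℝ) (K L : ℝ) (hK : ∀ x, |g x| ≤ K) (hg : Continuous g) (hL0 : 0 ≤ L)
    (hL : ∀ x y, |g x - g y| ≤ L * |x - y|)
    (a b : ℝ) (ha : 0 < a) (hab : a ≤ b) :
    |∫ ω, g (((π a ω : ℝ) - a) / Real.sqrt a) * g (((π b ω : ℝ) - b) / Real.sqrt b) ∂P
      - (∫ ω, g (((π a ω : ℝ) - a) / Real.sqrt a) ∂P) * (∫ ω, g (((π b ω : ℝ) - b) / Real.sqrt b) ∂P)|
      ≤ 2 * K * L * Real.sqrt (a / b) := by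
  have hK0 : 0 ≤ K := (abs_nonneg _).trans (hK 0)
  have hb : 0 < b := ha.trans_le hab
  have hqb := Real.sqrt_pos.2 hb
  have hm : ∀ t, Measurable (fun ω => (π t ω : ℝ)) := fun t => by
    have := hπmeas t
    fun_prop
  have hma := hm a
  have hmb := hm b
  have hm0 := hm 0
  have hgm := hg.measurable
  set A : Ω → ℝ := fun ω => g (((π a ω : ℝ) - a) / Real.sqrt a) with hA
  set B : Ω → ℝ := fun ω => g (((π b ω : ℝ) - b) / Real.sqrt b) with hB
  set B' : Ω → ℝ := fun ω => g (((π b ω : ℝ) - π a ω - (b - a)) / Real.sqrt b) with hB'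
  have mA : Measurable A := by fun_prop
  have mB : Measurable B := by fun_prop
  have mB' : Measurable B' := by fun_prop
  have bdd : ∀ F : Ω → ℝ, Measurable F → ∀ c : ℝ, (∀ ω, |F ω| ≤ c) → Integrable F P := by
    intro F hF c hc
    exact Integrable.of_bound hF.aestronglyMeasurable c (Eventually.of_forall hc)
  have iA := bdd A mA K fun ω => hK _
  have iB := bdd B mB K fun ω => hK _
  have iB' := bdd B' mB' K fun ω => hK _
  have iAB := bdd (fun ω => A ω * B ω) (mA.mul mB) (K*K) fun ω => by
    rw [abs_mul]; exact mul_le_mul (hK _) (hK _) (abs_nonneg _) hK0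
  have iAB' := bdd (fun ω => A ω * B' ω) (mA.mul mB') (K*K) fun ω => by
    rw [abs_mul]; exact mul_le_mul (hK _) (hK _) (abs_nonneg _) hK0
  -- independence
  have hind : ∫ ω, A ω * B' ω ∂P = (∫ ω, A ω ∂P) * ∫ ω, B' ω ∂P := by
    have hI := hπindep 2 ![0, a, b] (by
      intro i j hij
      fin_cases i <;> fin_cases j <;> simp_all <;> linarith) (by simp)
    have hI2 : IndepFun (fun ω => (π a ω : ℝ) - (π 0 ω : ℝ)) (fun ω => (π b ω : ℝ) - (π a ω : ℝ)) P := by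
      have := hI.indepFun (i := 0) (j := 1) (by simp)
      simpa using this
    have h1 := hI2.integral_fun_comp_mul_comp (f := fun x : ℝ => g ((x - a) / Real.sqrt a))
      (g := fun x : ℝ => g ((x - (b - a)) / Real.sqrt b)) (by fun_prop) (by fun_prop)
      (by fun_prop) (by fun_prop)
    have e1 : ∫ ω, A ω * B' ω ∂P = ∫ ω, g (((π a ω : ℝ) - (π 0 ω : ℝ) - a) / Real.sqrt a) * g (((π b ω : ℝ) - π a ω - (b - a)) / Real.sqrt b) ∂P := by
      refine integral_congr_ae ?_
      filter_upwards [hπ0] with ω hω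
      simp [hA, hB', hω]
    have e2 : ∫ ω, A ω ∂P = ∫ ω, g (((π a ω : ℝ) - (π 0 ω : ℝ) - a) / Real.sqrt a) ∂P := by
      refine integral_congr_ae ?_
      filter_upwards [hπ0] with ω hω
      simp [hA, hω]
    rw [e1, e2]; exact h1
  have hlaw := pp_law P π hπ0 hπdist a ha
  have hp := pois_abs a.toNNReal (by simpa using ha)
  rw [← hlaw, Real.coe_toNNReal _ ha.le] at hp
  have iM : Integrable (fun ω => |(π a ω : ℝ) - a|) P := by
    have := hp.1
    rwa [integrable_map_measure (by fun_prop) (by fun_prop)] at this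
  have hM : ∫ ω, |(π a ω : ℝ) - a| ∂P ≤ Real.sqrt a := by
    have := hp.2
    rwa [integral_map (by fun_prop) (by fun_prop)] at this
  have hBB : ∀ ω, |B ω - B' ω| ≤ L / Real.sqrt b * |(π a ω : ℝ) - a| := by
    intro ω
    refine (hL _ _).trans (le_of_eq ?_)
    have e : ((π b ω : ℝ) - b) / Real.sqrt b - ((π b ω : ℝ) - π a ω - (b - a)) / Real.sqrt b = ((π a ω : ℝ) - a) / Real.sqrt b := by
      ring
    rw [e, abs_div, abs_of_pos hqb]
    ring
  have iD : Integrable (fun ω => |B ω - B' ω|) P := (iB.sub iB').abs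
  have hE : ∫ ω, |B ω - B' ω| ∂P ≤ L * Real.sqrt (a / b) := by
    refine (integral_mono iD (iM.const_mul _) hBB).trans ?_
    rw [integral_const_mul, Real.sqrt_div ha.le]
    calc _ ≤ L / Real.sqrt b * Real.sqrt a := by gcongr
      _ = _ := by ring
  have h1 : |∫ ω, A ω * (B ω - B' ω) ∂P| ≤ K * (L * Real.sqrt (a / b)) := by
    refine (abs_integral_le_integral_abs).trans ?_
    refine (integral_mono_of_nonneg (Eventually.of_forall fun ω => abs_nonneg _) (iD.const_mul K) (Eventually.of_forall fun ω => ?_)).trans ?_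
    · simp only [abs_mul]
      exact mul_le_mul_of_nonneg_right (hK _) (abs_nonneg _)
    · rw [integral_const_mul]
      exact mul_le_mul_of_nonneg_left hE hK0
  have h2 : |(∫ ω, A ω ∂P) * ∫ ω, (B ω - B' ω) ∂P| ≤ K * (L * Real.sqrt (a / b)) := by
    rw [abs_mul]
    refine mul_le_mul ?_ ((abs_integral_le_integral_abs).trans hE) (abs_nonneg _) hK0
    refine (abs_integral_le_integral_abs).trans ?_
    refine (integral_mono iA.abs (integrable_const K) fun ω => hK _).trans ?_
    simp
  have e : ∫ ω, A ω * B ω ∂P - (∫ ω, A ω ∂P) * ∫ ω, B ω ∂P =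
     ∫ ω, A ω * (B ω - B' ω) ∂P - (∫ ω, A ω ∂P) * ∫ ω, (B ω - B' ω) ∂P := by
    simp only [mul_sub]
    rw [integral_sub iAB iAB', integral_sub iB iB', hind]; ring
  rw [e]
  refine (abs_sub _ _).trans ?_
  linarith

lemma second_moment {Ω : Type*} [MeasurableSpace Ω] (P : Measure Ω) [IsProbabilityMeasure P]
    (ν : Measure ℝ) [IsFiniteMeasure ν] (h : ℝ → Ω → ℝ) (hm : Measurable (Function.uncurry h))
    (K : ℝ) (hK : ∀ s ω, |h s ω| ≤ K) :
    ∫ ω, (∫ s, h s ω ∂ν)^2 ∂P = ∫ s, ∫ t, ∫ ω, h s ω * h t ω ∂P ∂ν ∂ν := by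
  have hK0 : ∀ (ω : Ω), 0 ≤ K := fun ω => (abs_nonneg _).trans (hK 0 ω)
  have e1 : ∀ ω, (∫ s, h s ω ∂ν)^2 = ∫ z : ℝ × ℝ, h z.1 ω * h z.2 ω ∂(ν.prod ν) := by
    intro ω
    rw [sq, ← integral_prod_mul]
  simp_rw [e1]
  have hmeas : Measurable (fun q : Ω × (ℝ × ℝ) => h q.2.1 q.1 * h q.2.2 q.1) := by
    refine Measurable.mul ?_ ?_
    · exact hm.comp (by fun_prop : Measurable fun q : Ω × (ℝ × ℝ) => (q.2.1, q.1))
    · exact hm.comp (by fun_prop : Measurable fun q : Ω × (ℝ × ℝ) => (q.2.2, q.1))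
  have hint : Integrable (fun q : Ω × (ℝ × ℝ) => h q.2.1 q.1 * h q.2.2 q.1) (P.prod (ν.prod ν)) := by
    refine Integrable.of_bound hmeas.aestronglyMeasurable (K*K) (Eventually.of_forall fun q => ?_)
    rw [Real.norm_eq_abs, abs_mul]
    exact mul_le_mul (hK _ _) (hK _ _) (abs_nonneg _) (hK0 q.1)
  rw [integral_integral_swap hint]
  have := hint.integral_prod_right
  rw [integral_prod _ this]

lemma kernel_bound (s S γ : ℝ) (hγ : 0 < γ) (hs : 1 ≤ s) (hS : s ≤ S) (k : ℝ → ℝ)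
    (hk : IntervalIntegrable k volume 1 S)
    (h1 : ∀ t ∈ Set.Icc 1 s, k t ≤ s ^ (-γ) * t ^ (γ - 1))
    (h2 : ∀ t ∈ Set.Icc s S, k t ≤ s ^ γ * t ^ (-γ - 1)) :
    ∫ t in (1:ℝ)..S, k t ≤ 2 / γ := by
  have hs0 : 0 < s := by linarith
  have hS0 : 0 < S := by linarith
  have hk1 : IntervalIntegrable k volume 1 s := hk.mono_set (by
    rw [Set.uIcc_of_le hs, Set.uIcc_of_le (hs.trans hS)]; exact Set.Icc_subset_Icc_right hS)
  have hk2 : IntervalIntegrable k volume s S := hk.mono_set (by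
    rw [Set.uIcc_of_le hS, Set.uIcc_of_le (hs.trans hS)]; exact Set.Icc_subset_Icc_left hs)
  have n1 : (0:ℝ) ∉ Set.uIcc 1 s := by rw [Set.uIcc_of_le hs]; intro h; linarith [h.1]
  have n2 : (0:ℝ) ∉ Set.uIcc s S := by rw [Set.uIcc_of_le hS]; intro h; linarith [h.1]
  rw [← intervalIntegral.integral_add_adjacent_intervals hk1 hk2]
  have b1 := intervalIntegral.integral_mono_on hs hk1 ((intervalIntegral.intervalIntegrable_rpow (r := γ - 1) (Or.inr n1)).const_mul (s ^ (-γ))) h1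
  have b2 := intervalIntegral.integral_mono_on hS hk2 ((intervalIntegral.intervalIntegrable_rpow (r := -γ - 1) (Or.inr n2)).const_mul (s ^ (γ))) h2
  rw [intervalIntegral.integral_const_mul, integral_rpow (Or.inl (by linarith))] at b1
  rw [intervalIntegral.integral_const_mul, integral_rpow (Or.inr ⟨by linarith, n2⟩)] at b2
  have c1 : s ^ (-γ) * ((s ^ (γ - 1 + 1) - 1 ^ (γ - 1 + 1)) / (γ - 1 + 1)) ≤ 1 / γ := by
    rw [sub_add_cancel, Real.one_rpow, ← mul_div_assoc]
    gcongr
    rw [mul_sub, ← Real.rpow_add hs0]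
    simp only [neg_add_cancel, Real.rpow_zero, mul_one]
    linarith [Real.rpow_pos_of_pos hs0 (-γ)]
  have c2 : s ^ γ * ((S ^ (-γ - 1 + 1) - s ^ (-γ - 1 + 1)) / (-γ - 1 + 1)) ≤ 1 / γ := by
    rw [sub_add_cancel, div_neg, ← neg_div, neg_sub, ← mul_div_assoc]
    gcongr
    rw [mul_sub, ← Real.rpow_add hs0]
    simp only [add_neg_cancel, Real.rpow_zero]
    have := mul_pos (Real.rpow_pos_of_pos hs0 γ) (Real.rpow_pos_of_pos hS0 (-γ))
    linarith
  have : 2 / γ = 1 / γ + 1 / γ := by ring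
  linarith

lemma moment_bound {Ω : Type*} [MeasurableSpace Ω] (P : Measure Ω) [IsProbabilityMeasure P]
    (Z : ℝ → Ω → ℝ) (hZ : Measurable (Function.uncurry Z)) (K : ℝ) (hK : ∀ s ω, |Z s ω| ≤ K)
    (C γ : ℝ) (hC : 0 ≤ C) (hγ : 0 < γ)
    (hcov : ∀ s t, 1 ≤ s → s ≤ t → |∫ ω, Z s ω * Z t ω ∂P| ≤ C * (s / t) ^ γ)
    (d : ℝ → ℝ) (hd : Antitone d) (hd0 : ∀ s, 0 < d s) (hd1 : ∀ s, d s ≤ d 1) (M : ℝ) (hM : ∀ s, 1 ≤ s → d s ≤ M / s) (S : ℝ) (hS : 1 ≤ S) :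
    ∫ ω, (∫ s in (1:ℝ)..S, Z s ω * d s)^2 ∂P ≤ (C * M * (2 / γ)) * ∫ s in (1:ℝ)..S, d s := by
  have hM0 : 0 ≤ M := by have := hM 1 le_rfl; have := hd0 1; simp at *; linarith
  have hdm : Measurable d := hd.measurable
  simp_rw [intervalIntegral.integral_of_le hS]
  have hmeas : Measurable (Function.uncurry fun s ω => Z s ω * d s) :=
    hZ.mul (hdm.comp measurable_fst)
  have hbd : ∀ s (ω : Ω), |Z s ω * d s| ≤ K * d 1 := by
    intro s ω
    rw [abs_mul, abs_of_pos (hd0 s)]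
    exact mul_le_mul (hK _ _) (hd1 s) (hd0 s).le ((abs_nonneg _).trans (hK s ω))
  rw [second_moment P (volume.restrict (Set.Ioc 1 S)) (fun s ω => Z s ω * d s) hmeas (K * d 1) hbd]
  have hdi : Integrable d (volume.restrict (Set.Ioc 1 S)) :=
    Integrable.of_bound hdm.aestronglyMeasurable (d 1) (Eventually.of_forall fun s => by
      rw [Real.norm_of_nonneg (hd0 s).le]; exact hd1 s)
  -- G s t
  have hG : ∀ s t, ∫ ω, Z s ω * d s * (Z t ω * d t) ∂P = d s * (d t * ∫ ω, Z s ω * Z t ω ∂P) := by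
    intro s t
    rw [← integral_const_mul, ← integral_const_mul]
    congr 1; ext ω; ring
  simp_rw [hG]
  have hne : Nonempty Ω := nonempty_of_isProbabilityMeasure P
  obtain ⟨ω0⟩ := hne
  have hK0 : 0 ≤ K := (abs_nonneg _).trans (hK 0 ω0)
  have hcb : ∀ s t, |∫ ω, Z s ω * Z t ω ∂P| ≤ K * K := by
    intro s t
    have : ‖∫ ω, Z s ω * Z t ω ∂P‖ ≤ K * K * P.real Set.univ :=
      norm_integral_le_of_norm_le_const (Eventually.of_forall fun ω => by
        rw [Real.norm_eq_abs, abs_mul]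
        exact mul_le_mul (hK _ _) (hK _ _) (abs_nonneg _) hK0)
    simpa using this
  have hcm : StronglyMeasurable (fun q : ℝ × ℝ => d q.2 * ∫ ω, Z q.1 ω * Z q.2 ω ∂P) := by
    refine (hdm.comp measurable_snd).stronglyMeasurable.mul ?_
    refine StronglyMeasurable.integral_prod_right (f := fun (q : ℝ × ℝ) ω => Z q.1 ω * Z q.2 ω) ?_
    refine Measurable.stronglyMeasurable (Measurable.mul ?_ ?_)
    · exact hZ.comp (by fun_prop : Measurable fun q : (ℝ × ℝ) × Ω => (q.1.1, q.2))
    · exact hZ.comp (by fun_prop : Measurable fun q : (ℝ × ℝ) × Ω => (q.1.2, q.2))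
  have hin : ∀ s, Integrable (fun t => d t * ∫ ω, Z s ω * Z t ω ∂P) (volume.restrict (Set.Ioc 1 S)) := by
    intro s
    refine Integrable.of_bound (hcm.comp_measurable (by fun_prop : Measurable fun t : ℝ => (s, t))).aestronglyMeasurable (d 1 * (K*K)) (Eventually.of_forall fun t => ?_)
    rw [Real.norm_eq_abs, abs_mul, abs_of_pos (hd0 t)]
    exact mul_le_mul (hd1 t) (hcb _ _) (abs_nonneg _) (hd0 1).le
  have inner : ∀ s ∈ Set.Ioc 1 S, ∫ t in Set.Ioc 1 S, d t * ∫ ω, Z s ω * Z t ω ∂P ≤ C * M * (2 / γ) := by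
    intro s hs
    have hs0 : 0 < s := by linarith [hs.1]
    by_cases hCM : C * M = 0
    · refine (integral_nonpos_of_ae ?_).trans (by rw [hCM]; simp)
      refine (ae_restrict_iff' measurableSet_Ioc).2 (Eventually.of_forall fun t ht => ?_)
      rcases mul_eq_zero.1 hCM with h | h
      · have : ∫ ω, Z s ω * Z t ω ∂P = 0 := by
          rcases le_total s t with hst | hst
          · have := hcov s t hs.1.le hst
            rw [h, zero_mul] at this
            exact abs_nonpos_iff.1 this
          · have := hcov t s ht.1.le hst
            rw [h, zero_mul] at this
            simp_rw [mul_comm (Z s _)]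
            exact abs_nonpos_iff.1 this
        simp [this]
      · have := hM 1 le_rfl
        have := hd0 1
        simp [h] at *; linarith
    have hCM0 : 0 < C * M := lt_of_le_of_ne (by positivity) (Ne.symm hCM)
    rw [← div_le_iff₀' hCM0, ← integral_div, ← intervalIntegral.integral_of_le hS]
    refine kernel_bound s S γ hγ hs.1.le hs.2 _ ?_ ?_ ?_
    · rw [intervalIntegrable_iff_integrableOn_Ioc_of_le hS]
      exact (hin s).div_const _
    · intro t ht
      have ht0 : 0 < t := by linarith [ht.1]
      have h1 := hcov t s ht.1 ht.2
      simp_rw [mul_comm (Z t _)] at h1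
      rw [div_le_iff₀ hCM0]
      calc d t * ∫ ω, Z s ω * Z t ω ∂P ≤ M / t * (C * (t / s) ^ γ) :=
            mul_le_mul_of_nonneg (hM t ht.1) ((le_abs_self _).trans h1) (hd0 t).le (by positivity)
        _ = _ := by
          rw [Real.div_rpow ht0.le hs0.le, Real.rpow_neg hs0.le, Real.rpow_sub ht0, Real.rpow_one]
          field_simp
    · intro t ht
      have ht0 : 0 < t := by linarith [ht.1]
      have h1 := hcov s t hs.1.le ht.1
      rw [div_le_iff₀ hCM0]
      calc d t * ∫ ω, Z s ω * Z t ω ∂P ≤ M / t * (C * (s / t) ^ γ) :=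
            mul_le_mul_of_nonneg (hM t (hs.1.le.trans ht.1)) ((le_abs_self _).trans h1) (hd0 t).le (by positivity)
        _ = _ := by
          rw [Real.div_rpow hs0.le ht0.le, Real.rpow_sub ht0, Real.rpow_one, Real.rpow_neg ht0.le]
          field_simp
  simp_rw [integral_const_mul]
  rw [← integral_const_mul]
  refine integral_mono_ae ?_ (hdi.const_mul _) ?_
  · refine Integrable.of_bound (C := d 1 * (d 1 * (K*K) * (volume.restrict (Set.Ioc 1 S)).real Set.univ)) ?_ (Eventually.of_forall fun s => ?_)
    · refine (hdm.stronglyMeasurable.mul ?_).aestronglyMeasurable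
      exact StronglyMeasurable.integral_prod_right (f := fun (s t : ℝ) => d t * ∫ ω, Z s ω * Z t ω ∂P) hcm
    · rw [norm_mul, Real.norm_of_nonneg (hd0 s).le]
      refine mul_le_mul (hd1 s) ?_ (norm_nonneg _) (hd0 1).le
      refine norm_integral_le_of_norm_le_const (Eventually.of_forall fun t => ?_)
      rw [Real.norm_eq_abs, abs_mul, abs_of_pos (hd0 t)]
      exact mul_le_mul (hd1 t) (hcb _ _) (abs_nonneg _) (hd0 1).le
  · refine (ae_restrict_iff' measurableSet_Ioc).2 (Eventually.of_forall fun s hs => ?_)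
    simp only
    rw [mul_comm (C * M * (2/γ))]
    exact mul_le_mul_of_nonneg_left (inner s hs) (hd0 s).le

lemma anti_ii (d : ℝ → ℝ) (hd : Antitone d) (a b : ℝ) : IntervalIntegrable d volume a b :=
  (hd.antitoneOn _).intervalIntegrable

lemma asc_core {Ω : Type*} [MeasurableSpace Ω] (P : Measure Ω) [IsProbabilityMeasure P]
    (Z : ℝ → Ω → ℝ) (hZ : Measurable (Function.uncurry Z)) (K : ℝ) (hK : ∀ s ω, |Z s ω| ≤ K)
    (C γ : ℝ) (hC : 0 ≤ C) (hγ : 0 < γ)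
    (hcov : ∀ s t, 1 ≤ s → s ≤ t → |∫ ω, Z s ω * Z t ω ∂P| ≤ C * (s / t) ^ γ)
    (d : ℝ → ℝ) (hd : Antitone d) (hd0 : ∀ s, 0 < d s) (hd1 : ∀ s, d s ≤ d 1) (M : ℝ) (hM : ∀ s, 1 ≤ s → d s ≤ M / s)
    (hD : Tendsto (fun S : ℝ => ∫ s in (1 : ℝ)..S, d s) atTop atTop) :
    ∀ᵐ ω ∂P, Tendsto (fun S : ℝ => (1 / ∫ s in (1 : ℝ)..S, d s) * ∫ s in (1 : ℝ)..S, Z s ω * d s) atTop (𝓝 0) := by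
  have hdm : Measurable d := hd.measurable
  set D : ℝ → ℝ := fun S => ∫ s in (1 : ℝ)..S, d s with hDdef
  have hDc : Continuous D := intervalIntegral.continuous_primitive (anti_ii d hd) 1
  obtain ⟨ω0⟩ : Nonempty Ω := nonempty_of_isProbabilityMeasure P
  have hK0 : 0 ≤ K := (abs_nonneg _).trans (hK 0 ω0)
  have hM0 : 0 ≤ M := by have := hM 1 le_rfl; have := hd0 1; simp at *; linarith
  have hex : ∀ k : ℕ, ∃ S, 1 ≤ S ∧ D S = (k:ℝ)^2 := by
    intro k
    obtain ⟨S', hS1, hS2⟩ := ((eventually_ge_atTop (1:ℝ)).and (hD.eventually_ge_atTop ((k:ℝ)^2))).exists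
    have := intermediate_value_Icc hS1 hDc.continuousOn
    have h0 : D 1 = 0 := by simp [hDdef]
    obtain ⟨S, hS, hS'⟩ := this ⟨by rw [h0]; positivity, hS2⟩
    exact ⟨S, hS.1, hS'⟩
  choose σ hσ1 hσ2 using hex
  set T : ℝ → Ω → ℝ := fun S ω => ∫ s in (1 : ℝ)..S, Z s ω * d s with hT
  have hZs : ∀ ω, Measurable fun s => Z s ω := fun ω => hZ.comp (by fun_prop : Measurable fun s : ℝ => (s, ω))
  have hbd : ∀ s (ω : Ω), |Z s ω * d s| ≤ K * d s := by
    intro s ω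
    rw [abs_mul, abs_of_pos (hd0 s)]
    exact mul_le_mul_of_nonneg_right (hK _ _) (hd0 s).le
  have hZi : ∀ ω a b, IntervalIntegrable (fun s => Z s ω * d s) volume a b := by
    intro ω a b
    refine ((anti_ii d hd a b).const_mul K).mono_fun ((hZs ω).mul hdm).aestronglyMeasurable (Eventually.of_forall fun s => ?_)
    simp only [Real.norm_eq_abs]
    exact (hbd s ω).trans (le_abs_self _)
  have hdiff : ∀ ω a b, |T b ω - T a ω| ≤ K * |D b - D a| := by
    intro ω a b
    simp only [hT, hDdef]
    rw [intervalIntegral.integral_interval_sub_left (hZi ω _ _) (hZi ω _ _),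
      intervalIntegral.integral_interval_sub_left (anti_ii d hd _ _) (anti_ii d hd _ _)]
    have := intervalIntegral.norm_integral_le_abs_of_norm_le (μ := volume) (f := fun s => Z s ω * d s) (g := fun s => K * d s) (a := a) (b := b)
      (Eventually.of_forall fun s => hbd s ω) ((anti_ii d hd a b).const_mul K)
    rw [intervalIntegral.integral_const_mul, abs_mul, abs_of_nonneg hK0] at this
    exact this
  have hTm : ∀ S, 1 ≤ S → Measurable (T S) := by
    intro S hS
    have : T S = fun ω => ∫ s, Z s ω * d s ∂(volume.restrict (Set.Ioc 1 S)) := by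
      ext ω; simp only [hT]; rw [intervalIntegral.integral_of_le hS]
    rw [this]
    refine (StronglyMeasurable.integral_prod_right (f := fun ω s => Z s ω * d s) ?_).measurable
    exact ((hZ.comp measurable_swap).mul (hdm.comp measurable_snd)).stronglyMeasurable
  have hTb : ∀ S ω, |T S ω| ≤ K * |D S| := by
    intro S ω
    have := hdiff ω 1 S
    simpa [hT, hDdef] using this
  set V : ℕ → Ω → ℝ := fun k ω => (T (σ k) ω * ((k:ℝ)^2)⁻¹)^2 with hV
  have hVm : ∀ k, Measurable (V k) := fun k => ((hTm _ (hσ1 k)).mul_const _).pow_const 2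
  have hVi : ∀ k, Integrable (V k) P := by
    intro k
    refine Integrable.of_bound (hVm k).aestronglyMeasurable ((K * |D (σ k)| * ((k:ℝ)^2)⁻¹)^2) (Eventually.of_forall fun ω => ?_)
    rw [Real.norm_eq_abs, hV]
    simp only
    rw [abs_of_nonneg (sq_nonneg _), ← sq_abs, abs_mul, abs_of_nonneg (by positivity : 0 ≤ ((k:ℝ)^2)⁻¹)]
    gcongr
    exact hTb _ _
  set c := C * M * (2 / γ) with hc
  have hc0 : 0 ≤ c := by positivity
  have hVb : ∀ k, ∫ ω, V k ω ∂P ≤ c * ((k:ℝ)^2)⁻¹ := by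
    intro k
    have := moment_bound P Z hZ K hK C γ hC hγ hcov d hd hd0 hd1 M hM (σ k) (hσ1 k)
    have h2 : (∫ s in (1:ℝ)..(σ k), d s) = (k:ℝ)^2 := hσ2 k
    rw [h2] at this
    simp only [hV, mul_pow]
    rw [integral_mul_const]
    refine (mul_le_mul_of_nonneg_right this (by positivity)).trans (le_of_eq ?_)
    rcases eq_or_ne (k:ℝ) 0 with h | h
    · simp [h]
    · rw [hc]; field_simp
  have hsum : Summable fun k : ℕ => c * ((k:ℝ)^2)⁻¹ := (Real.summable_nat_pow_inv.2 (by norm_num)).mul_left c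
  have hlin : ∫⁻ ω, ∑' k, ENNReal.ofReal (V k ω) ∂P ≠ ⊤ := by
    rw [lintegral_tsum fun k => (hVm k).ennreal_ofReal.aemeasurable]
    refine ne_top_of_le_ne_top (b := ENNReal.ofReal (∑' k : ℕ, c * ((k:ℝ)^2)⁻¹)) ENNReal.ofReal_ne_top ?_
    rw [ENNReal.ofReal_tsum_of_nonneg (fun k => by positivity) hsum]
    refine ENNReal.tsum_le_tsum fun k => ?_
    rw [← ofReal_integral_eq_lintegral_ofReal (hVi k) (Eventually.of_forall fun ω => sq_nonneg _)]
    exact ENNReal.ofReal_le_ofReal (hVb k)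
  have hae := ae_lt_top (Measurable.tsum fun k => (hVm k).ennreal_ofReal) hlin
  filter_upwards [hae] with ω hω
  have hV0 : Tendsto (fun k => V k ω) atTop (𝓝 0) := by
    have := ENNReal.tendsto_atTop_zero_of_tsum_ne_top hω.ne
    have := (ENNReal.tendsto_toReal ENNReal.zero_ne_top).comp this
    refine this.congr fun k => ?_
    simp only [Function.comp]
    rw [ENNReal.toReal_ofReal (sq_nonneg _)]
  have hA0 : Tendsto (fun k : ℕ => |T (σ k) ω * ((k:ℝ)^2)⁻¹|) atTop (𝓝 0) := by
    have := (Real.continuous_sqrt.tendsto 0).comp hV0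
    rw [Real.sqrt_zero] at this
    refine this.congr fun k => ?_
    simp only [Function.comp, hV]
    rw [Real.sqrt_sq_eq_abs]
  have hB0 : Tendsto (fun k : ℕ => K * (2 * (k:ℝ)⁻¹ + (k:ℝ)⁻¹ * (k:ℝ)⁻¹)) atTop (𝓝 0) := by
    have h := tendsto_inv_atTop_nhds_zero_nat (𝕜 := ℝ)
    simpa using ((h.const_mul 2).add (h.mul h)).const_mul K
  have hn : Tendsto (fun S => ⌊Real.sqrt (D S)⌋₊) atTop atTop :=
    tendsto_nat_floor_atTop.comp (Real.tendsto_sqrt_atTop.comp hD)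
  have hfin := (hA0.add hB0).comp hn
  rw [add_zero] at hfin
  refine squeeze_zero_norm' ?_ hfin
  filter_upwards [hn.eventually_ge_atTop 1, hD.eventually_ge_atTop 1] with S hS1 hS2
  have hDS : (1:ℝ) ≤ D S := hS2
  change ‖1 / D S * T S ω‖ ≤ _
  simp only [Function.comp]
  set n := ⌊Real.sqrt (D S)⌋₊ with hnn
  have hn1 : (1:ℝ) ≤ n := by exact_mod_cast hS1
  have hle : (n:ℝ) ≤ Real.sqrt (D S) := Nat.floor_le (Real.sqrt_nonneg _)
  have hlt : Real.sqrt (D S) < n + 1 := Nat.lt_floor_add_one _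
  have hsq : Real.sqrt (D S) ^ 2 = D S := Real.sq_sqrt (by linarith)
  have hD1 : (n:ℝ)^2 ≤ D S := by rw [← hsq]; gcongr
  have hD2 : D S ≤ (n:ℝ)^2 + (2 * n + 1) := by rw [← hsq]; nlinarith [Real.sqrt_nonneg (D S)]
  have h1 := hdiff ω (σ n) S
  rw [hσ2 n, abs_of_nonneg (sub_nonneg.2 hD1)] at h1
  have h2 : |T S ω| ≤ |T (σ n) ω| + K * (2 * n + 1) := by
    have : |T S ω| ≤ |T (σ n) ω| + |T S ω - T (σ n) ω| := by
      have := abs_add_le (T (σ n) ω) (T S ω - T (σ n) ω)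
      simpa using this
    have : K * (D S - (n:ℝ)^2) ≤ K * (2 * n + 1) := by gcongr; linarith
    linarith
  rw [Real.norm_eq_abs, abs_mul, abs_of_pos (by positivity : 0 < 1 / D S), abs_mul, abs_of_pos (by positivity : 0 < ((n:ℝ)^2)⁻¹)]
  calc 1 / D S * |T S ω| ≤ 1 / (n:ℝ)^2 * (|T (σ n) ω| + K * (2 * n + 1)) := by gcongr
    _ = _ := by field_simp

lemma cesaro (d : ℝ → ℝ) (hd : Antitone d) (hd0 : ∀ s, 0 < d s)
    (hD : Tendsto (fun S : ℝ => ∫ s in (1 : ℝ)..S, d s) atTop atTop)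
    (m : ℝ → ℝ) (K : ℝ) (hm : Measurable m) (hK : ∀ s, |m s| ≤ K) (hl : Tendsto m atTop (𝓝 0)) :
    Tendsto (fun S : ℝ => (1 / ∫ s in (1 : ℝ)..S, d s) * ∫ s in (1 : ℝ)..S, m s * d s) atTop (𝓝 0) := by
  have hdm : Measurable d := hd.measurable
  have hi : ∀ a b, IntervalIntegrable (fun s => m s * d s) volume a b := by
    intro a b
    refine ((anti_ii d hd a b).const_mul K).mono_fun (hm.mul hdm).aestronglyMeasurable (Eventually.of_forall fun s => ?_)
    simp only [Real.norm_eq_abs]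
    refine le_trans ?_ (le_abs_self _)
    rw [abs_mul, abs_of_pos (hd0 s)]
    exact mul_le_mul_of_nonneg_right (hK _) (hd0 s).le
  rw [Metric.tendsto_atTop']
  intro ε hε
  obtain ⟨A, hA⟩ := (Metric.tendsto_atTop.1 hl) (ε/2) (by positivity)
  set A' := max A 1
  set c := |∫ s in (1 : ℝ)..A', m s * d s| with hc
  obtain ⟨N, hN⟩ := eventually_atTop.1 ((eventually_ge_atTop A').and (hD.eventually_gt_atTop (2 * c / ε)))
  refine ⟨N, fun S hS => ?_⟩
  obtain ⟨h1, h2⟩ := hN S hS.le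
  have hA'1 : 1 ≤ A' := le_max_right _ _
  rw [← intervalIntegral.integral_add_adjacent_intervals (hi 1 A') (hi A' S)]
  have hDadd := intervalIntegral.integral_add_adjacent_intervals (anti_ii d hd 1 A') (anti_ii d hd A' S)
  have hD0 : 0 ≤ ∫ s in (1 : ℝ)..A', d s := intervalIntegral.integral_nonneg hA'1 fun s _ => (hd0 s).le
  have hD1 : 0 ≤ ∫ s in A'..S, d s := intervalIntegral.integral_nonneg h1 fun s _ => (hd0 s).le
  set Δ := ∫ s in (1 : ℝ)..S, d s with hΔ
  have hΔ0 : 0 < Δ := lt_of_le_of_lt (by positivity) h2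
  have hb : |∫ s in A'..S, m s * d s| ≤ ε/2 * ∫ s in A'..S, d s := by
    have := intervalIntegral.norm_integral_le_of_norm_le (μ := volume) (f := fun s => m s * d s) (g := fun s => ε/2 * d s) h1
      (Eventually.of_forall fun s hs => by
        have h3 := hA s ((le_max_left _ _).trans hs.1.le)
        rw [Real.dist_eq, sub_zero] at h3
        rw [Real.norm_eq_abs, abs_mul, abs_of_pos (hd0 s)]
        exact mul_le_mul_of_nonneg_right h3.le (hd0 s).le) ((anti_ii d hd _ _).const_mul _)
    rw [intervalIntegral.integral_const_mul] at this
    exact this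
  rw [Real.dist_eq, sub_zero, abs_mul, abs_of_pos (by positivity : 0 < 1 / Δ), one_div, inv_mul_lt_iff₀ hΔ0]
  rw [div_lt_iff₀ hε] at h2
  have h5 : ε/2 * (∫ s in A'..S, d s) ≤ ε/2 * Δ := by gcongr; linarith
  have := abs_add_le (∫ s in (1 : ℝ)..A', m s * d s) (∫ s in A'..S, m s * d s)
  linarith

lemma avg_measure (d : ℝ → ℝ) (hd : Antitone d) (hd0 : ∀ s, 0 < d s) (X : ℝ → ℝ) (hX : Measurable X) (S : ℝ) (hS : 1 < S) :
    ∃ μ : ProbabilityMeasure ℝ, ∀ h : ℝ → ℝ, Continuous h → ∫ x, h x ∂(μ : Measure ℝ) =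
      (1 / ∫ s in (1 : ℝ)..S, d s) * ∫ s in (1 : ℝ)..S, h (X s) * d s := by
  have hdm : Measurable d := hd.measurable
  have hpos : 0 < ∫ s in (1 : ℝ)..S, d s :=
    intervalIntegral.intervalIntegral_pos_of_pos (anti_ii d hd _ _) hd0 hS
  set Δ := ∫ s in (1 : ℝ)..S, d s with hΔ
  set ν := (volume.restrict (Set.Ioc 1 S)).withDensity (fun s => ENNReal.ofReal (d s)) with hν
  have hmass : ν Set.univ = ENNReal.ofReal Δ := by
    rw [hν, withDensity_apply _ MeasurableSet.univ, Measure.restrict_univ, hΔ, intervalIntegral.integral_of_le hS.le,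
      ofReal_integral_eq_lintegral_ofReal ((intervalIntegrable_iff_integrableOn_Ioc_of_le hS.le).1 (anti_ii d hd _ _)) (Eventually.of_forall fun s => (hd0 s).le)]
  let μ : Measure ℝ := (ENNReal.ofReal Δ)⁻¹ • Measure.map X ν
  have hμ : IsProbabilityMeasure μ := ⟨by
    simp only [μ, Measure.smul_apply, Measure.map_apply hX MeasurableSet.univ, Set.preimage_univ, hmass, smul_eq_mul]
    exact ENNReal.inv_mul_cancel (by simpa using hpos) ENNReal.ofReal_ne_top⟩
  refine ⟨⟨μ, hμ⟩, fun h hh => ?_⟩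
  simp only [ProbabilityMeasure.coe_mk, μ]
  rw [integral_smul_measure, integral_map hX.aemeasurable hh.aestronglyMeasurable, hν,
    integral_withDensity_eq_integral_toReal_smul (by fun_prop) (Eventually.of_forall fun s => ENNReal.ofReal_lt_top), intervalIntegral.integral_of_le hS.le,
    ENNReal.toReal_inv, ENNReal.toReal_ofReal hpos.le, smul_eq_mul, one_div]
  congr 1
  refine integral_congr_ae (Eventually.of_forall fun s => ?_)
  simp only [smul_eq_mul]
  rw [ENNReal.toReal_ofReal (hd0 s).le, mul_comm]

lemma d_bound (d : ℝ → ℝ) (hd : Antitone d) (hd0 : ∀ s, 0 < d s)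
    (hd_sum : ∀ k : ℕ, 1 ≤ k →
      ∫ s in (k : ℝ)..((k : ℝ) + 1), d s ≤ Real.log (Real.sqrt (((k : ℝ) + 1) / k))) :
    ∀ s, 1 ≤ s → d s ≤ (2 * d 1 + 3 / 2) / s := by
  intro s hs
  have hs0 : 0 < s := by linarith
  have h1 := hd0 1
  rw [le_div_iff₀ hs0]
  rcases le_total s 2 with h | h
  · have := hd hs
    nlinarith [hd0 s]
  · have hfl : 2 ≤ ⌊s⌋₊ := Nat.le_floor (by exact_mod_cast h)
    obtain ⟨k, hk⟩ : ∃ k : ℕ, ⌊s⌋₊ = k + 1 := ⟨⌊s⌋₊ - 1, by omega⟩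
    have hk1 : 1 ≤ k := by omega
    have hk1' : (1:ℝ) ≤ k := by exact_mod_cast hk1
    have hle : (k:ℝ) + 1 ≤ s := by
      have := Nat.floor_le hs0.le
      rw [hk] at this; push_cast at this; exact this
    have hlt : s < k + 2 := by
      have := Nat.lt_floor_add_one s
      rw [hk] at this; push_cast at this; linarith
    have hint : d s ≤ ∫ x in (k : ℝ)..((k : ℝ) + 1), d x := by
      have := intervalIntegral.integral_mono_on (a := (k:ℝ)) (b := k + 1) (f := fun _ => d s) (g := d) (μ := volume) (by linarith)
        (by simp) (anti_ii d hd _ _) (fun x hx => hd (hx.2.trans hle))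
      simpa using this
    have hlog : Real.log (Real.sqrt (((k : ℝ) + 1) / k)) ≤ 1 / (2 * k) := by
      rw [Real.log_sqrt (by positivity)]
      have := Real.log_le_sub_one_of_pos (by positivity : 0 < ((k : ℝ) + 1) / k)
      have e : ((k : ℝ) + 1) / k - 1 = 1 / k := by field_simp; ring
      rw [e] at this
      calc _ ≤ (1 / (k:ℝ)) / 2 := by gcongr
        _ = _ := by field_simp
    have hds := hint.trans ((hd_sum k hk1).trans hlog)
    have : d s * s ≤ 1 / (2 * k) * (3 * k) := by
      refine mul_le_mul hds (by linarith) hs0.le (by positivity)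
    have e : 1 / (2 * (k:ℝ)) * (3 * k) = 3 / 2 := by field_simp
    rw [e] at this
    linarith

lemma one_fun {Ω : Type*} [MeasurableSpace Ω] (P : Measure Ω) [IsProbabilityMeasure P]
    (π : ℝ → Ω → ℕ)
    (hπmeas : ∀ t, Measurable (π t))
    (hπ0 : ∀ᵐ ω ∂P, π 0 ω = 0)
    (hπindep : ∀ (k : ℕ) (t : Fin (k + 1) → ℝ), Monotone t → 0 ≤ t 0 →
      iIndepFun
        (fun i : Fin k => fun ω => (π (t i.succ) ω : ℝ) - (π (t i.castSucc) ω : ℝ)) P)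
    (hπdist : ∀ s t : ℝ, 0 ≤ s → s < t →
      Measure.map (fun ω => (π t ω : ℝ) - (π s ω : ℝ)) P
        = Measure.map (fun n : ℕ => (n : ℝ)) (poissonMeasure (t - s).toNNReal))
    (X : ℝ → Ω → ℝ) (hX : Measurable (Function.uncurry X))
    (f : ℝ → ℝ) (hXf : ∀ s ω, X s ω = ((π (f s) ω : ℝ) - f s) / Real.sqrt (f s))
    (hf_pos : ∀ x, 0 < f x) (hfmono : Monotone f) (hftop : Tendsto f atTop atTop)
    (β : ℝ) (hβ : 0 < β) (hB : ∀ s t : ℝ, 1 ≤ s → s ≤ t → f s / f t ≤ (s / t) ^ β)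
    (d : ℝ → ℝ) (hd : Antitone d) (hd0 : ∀ s, 0 < d s) (hd1 : ∀ s, d s ≤ d 1) (M : ℝ) (hM : ∀ s, 1 ≤ s → d s ≤ M / s)
    (hD : Tendsto (fun S : ℝ => ∫ s in (1 : ℝ)..S, d s) atTop atTop)
    (g : ℝ → ℝ) (K L : ℝ) (hK : ∀ x, |g x| ≤ K) (hg : Continuous g) (hL0 : 0 ≤ L)
    (hL : ∀ x y, |g x - g y| ≤ L * |x - y|) :
    ∀ᵐ ω ∂P, Tendsto (fun S : ℝ => (1 / ∫ s in (1 : ℝ)..S, d s) * ∫ s in (1 : ℝ)..S, g (X s ω) * d s) atTop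
      (𝓝 (∫ y, g y ∂(gaussianReal 0 1))) := by
  have hK0 : 0 ≤ K := (abs_nonneg _).trans (hK 0)
  set m : ℝ → ℝ := fun s => ∫ ω, g (X s ω) ∂P with hmdef
  set c := ∫ y, g y ∂(gaussianReal 0 1) with hcdef
  have hgX : Measurable (Function.uncurry fun s ω => g (X s ω)) := hg.measurable.comp hX
  have hgXs : ∀ s, Measurable fun ω => g (X s ω) := fun s => hgX.comp (by fun_prop : Measurable fun ω : Ω => (s, ω))
  have hgXω : ∀ ω, Measurable fun s => g (X s ω) := fun ω => hgX.comp (by fun_prop : Measurable fun s : ℝ => (s, ω))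
  have hmm : Measurable m := (StronglyMeasurable.integral_prod_right (f := fun s ω => g (X s ω)) hgX.stronglyMeasurable).measurable
  have hmK : ∀ s, |m s| ≤ K := by
    intro s
    have : ‖∫ ω, g (X s ω) ∂P‖ ≤ K * P.real Set.univ :=
      norm_integral_le_of_norm_le_const (Eventually.of_forall fun ω => hK _)
    simpa using this
  have hgi : ∀ s, Integrable (fun ω => g (X s ω)) P := fun s =>
    Integrable.of_bound (hgXs s).aestronglyMeasurable K (Eventually.of_forall fun ω => hK _)
  have hgg : ∀ s t, Integrable (fun ω => g (X s ω) * g (X t ω)) P := fun s t =>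
    Integrable.of_bound ((hgXs s).mul (hgXs t)).aestronglyMeasurable (K * K) (Eventually.of_forall fun ω => by
      rw [Real.norm_eq_abs, abs_mul]; exact mul_le_mul (hK _) (hK _) (abs_nonneg _) hK0)
  -- convergence of means
  have hmlim : Tendsto m atTop (𝓝 c) := by
    refine tendsto_of_seq_tendsto fun u hu => ?_
    have h1 := pois_clt (BoundedContinuousFunction.ofNormedAddCommGroup g hg K hK) (fun n => f (u n)) (fun n => hf_pos _) (hftop.comp hu)
    refine h1.congr fun n => ?_
    simp only [Function.comp, hmdef, BoundedContinuousFunction.coe_ofNormedAddCommGroup]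
    rw [← pp_law P π hπ0 hπdist _ (hf_pos (u n)), integral_map]
    · simp_rw [hXf]
    · have := hπmeas (f (u n))
      fun_prop
    · fun_prop
  set Z : ℝ → Ω → ℝ := fun s ω => g (X s ω) - m s with hZdef
  have hZ : Measurable (Function.uncurry Z) := hgX.sub (hmm.comp measurable_fst)
  have hZK : ∀ s ω, |Z s ω| ≤ 2 * K := by
    intro s ω
    refine (abs_sub _ _).trans ?_
    linarith [hK (X s ω), hmK s]
  have hcov : ∀ s t, 1 ≤ s → s ≤ t → |∫ ω, Z s ω * Z t ω ∂P| ≤ (2 * K * L) * (s / t) ^ (β / 2) := by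
    intro s t hs hst
    have e : ∫ ω, Z s ω * Z t ω ∂P = ∫ ω, g (X s ω) * g (X t ω) ∂P - m s * m t := by
      have : ∀ ω, Z s ω * Z t ω = g (X s ω) * g (X t ω) - m t * g (X s ω) - m s * g (X t ω) + m s * m t := by
        intro ω; simp only [hZdef]; ring
      simp_rw [this]
      have i1 : Integrable (fun ω => m t * g (X s ω)) P := (hgi s).const_mul _
      have i2 : Integrable (fun ω => m s * g (X t ω)) P := (hgi t).const_mul _
      have i3 : Integrable (fun ω => g (X s ω) * g (X t ω) - m t * g (X s ω)) P := (hgg s t).sub i1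
      have i4 : Integrable (fun ω => g (X s ω) * g (X t ω) - m t * g (X s ω) - m s * g (X t ω)) P := i3.sub i2
      rw [integral_add i4 (integrable_const _), integral_sub i3 i2,
        integral_sub (hgg s t) i1, integral_const_mul, integral_const_mul]
      simp only [integral_const, probReal_univ, one_smul]
      change _ - m t * m s - m s * m t + m s * m t = _
      ring
    have h1 := pp_cov P π hπmeas hπ0 hπindep hπdist g K L hK hg hL0 hL (f s) (f t) (hf_pos s) (hfmono hst)
    simp_rw [← hXf] at h1
    rw [e]
    refine h1.trans ?_
    gcongr
    have h0 : 0 ≤ s / t := div_nonneg (by linarith) (by linarith)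
    rw [div_eq_mul_one_div β 2, Real.rpow_mul h0, ← Real.sqrt_eq_rpow]
    exact Real.sqrt_le_sqrt (hB s t hs hst)
  have h1 := asc_core P Z hZ (2*K) hZK (2 * K * L) (β/2) (by positivity) (by positivity) hcov d hd hd0 hd1 M hM hD
  have h2 := cesaro d hd hd0 hD (fun s => m s - c) (K + |c|) (by fun_prop)
    (fun s => (abs_sub _ _).trans (by linarith [hmK s])) (by simpa using hmlim.sub_const c)
  filter_upwards [h1] with ω hω
  have h3 := (hω.add h2).add_const c
  rw [add_zero, zero_add] at h3
  refine h3.congr' ?_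
  filter_upwards [hD.eventually_gt_atTop 0] with S hS
  have hii : ∀ (q : ℝ → ℝ) (K : ℝ), Measurable q → (∀ s, |q s| ≤ K) → IntervalIntegrable (fun s => q s * d s) volume 1 S := by
    intro q K hq hqK
    refine ((anti_ii d hd 1 S).const_mul K).mono_fun (hq.mul hd.measurable).aestronglyMeasurable (Eventually.of_forall fun s => ?_)
    simp only [Real.norm_eq_abs]
    refine le_trans ?_ (le_abs_self _)
    rw [abs_mul, abs_of_pos (hd0 s)]
    exact mul_le_mul_of_nonneg_right (hqK _) (hd0 s).le
  have e : ∫ s in (1:ℝ)..S, g (X s ω) * d s = (∫ s in (1:ℝ)..S, Z s ω * d s) + (∫ s in (1:ℝ)..S, (m s - c) * d s) + c * ∫ s in (1:ℝ)..S, d s := by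
    rw [← intervalIntegral.integral_const_mul, ← intervalIntegral.integral_add, ← intervalIntegral.integral_add]
    · refine intervalIntegral.integral_congr fun s _ => ?_
      simp only [hZdef]; ring
    · exact (hii (fun s => Z s ω) (2*K) ((hgXω ω).sub hmm) (fun s => hZK s ω)).add (hii (fun s => m s - c) (K + |c|) (by fun_prop) (fun s => (abs_sub _ _).trans (by linarith [hmK s])))
    · exact (anti_ii d hd 1 S).const_mul c
    · exact hii (fun s => Z s ω) (2*K) ((hgXω ω).sub hmm) (fun s => hZK s ω)
    · exact hii (fun s => m s - c) (K + |c|) (by fun_prop) (fun s => (abs_sub _ _).trans (by linarith [hmK s]))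
  rw [e]
  field_simp

/-- **One-dimensional marginal form of Corollary 5.**
Let `π` be a Poisson process of intensity 1, let `f` satisfy condition (B) and `d`
condition (C), and let `D(S) = ∫_1^S d(s) ds`. Then almost surely
`(1/D(S)) ∫_1^S g ((π(f(s)) - f(s))/√f(s)) d(s) ds → ∫ g dN(0, 1)`
for every bounded continuous `g`. -/
theorem stmt13
    {Ω : Type*} [MeasurableSpace Ω] (P : Measure Ω) [IsProbabilityMeasure P]
    (π : ℝ → Ω → ℕ)
    (hπmeas : ∀ t, Measurable (π t))
    (hπ0 : ∀ᵐ ω ∂P, π 0 ω = 0)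
    (hπindep : ∀ (k : ℕ) (t : Fin (k + 1) → ℝ), Monotone t → 0 ≤ t 0 →
      iIndepFun
        (fun i : Fin k => fun ω => (π (t i.succ) ω : ℝ) - (π (t i.castSucc) ω : ℝ)) P)
    (hπdist : ∀ s t : ℝ, 0 ≤ s → s < t →
      Measure.map (fun ω => (π t ω : ℝ) - (π s ω : ℝ)) P
        = Measure.map (fun n : ℕ => (n : ℝ)) (poissonMeasure (t - s).toNNReal))
    (hπjoint : Measurable (Function.uncurry fun (s : ℝ) (ω : Ω) => π s ω))
    (f : ℝ → ℝ) (hf_pos : ∀ x, 1 ≤ x → 0 < f x)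
    (β : ℝ) (hβ : 0 < β)
    (hB : ∀ x y : ℝ, 1 ≤ x → x ≤ y → f x / x ^ β ≤ f y / y ^ β)
    (d : ℝ → ℝ) (hd_pos : ∀ s, 1 ≤ s → 0 < d s)
    (hd_dec : ∀ x y : ℝ, 1 ≤ x → x ≤ y → d y ≤ d x)
    (hd_sum : ∀ k : ℕ, 1 ≤ k →
      ∫ s in (k : ℝ)..((k : ℝ) + 1), d s ≤ Real.log (Real.sqrt (((k : ℝ) + 1) / k)))
    (hd_div : Tendsto (fun S : ℝ => ∫ s in (1 : ℝ)..S, d s) atTop atTop) :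
    ∀ᵐ ω ∂P, ∀ g : BoundedContinuousFunction ℝ ℝ,
      Tendsto (fun S : ℝ =>
          (1 / ∫ s in (1 : ℝ)..S, d s) *
            ∫ s in (1 : ℝ)..S,
              g (((π (f s) ω : ℝ) - f s) / Real.sqrt (f s)) * d s) atTop
        (𝓝 (∫ y, g y ∂(gaussianReal 0 1))) := by
  -- globalised data
  set F : ℝ → ℝ := fun s => f (max 1 s) with hF
  set e : ℝ → ℝ := fun s => d (max 1 s) with he
  have hm1 : ∀ s : ℝ, 1 ≤ max 1 s := fun s => le_max_left _ _
  have hFpos : ∀ s, 0 < F s := fun s => hf_pos _ (hm1 s)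
  have hratio : ∀ x y : ℝ, 1 ≤ x → x ≤ y → f x / f y ≤ (x / y) ^ β := by
    intro x y hx hxy
    have hx0 : 0 < x := by linarith
    have hy0 : 0 < y := by linarith
    have h := hB x y hx hxy
    have hxp := Real.rpow_pos_of_pos hx0 β
    have hyp := Real.rpow_pos_of_pos hy0 β
    have hfy := hf_pos y (hx.trans hxy)
    rw [Real.div_rpow hx0.le hy0.le, div_le_div_iff₀ hfy hyp]
    rw [div_le_div_iff₀ hxp hyp] at h
    linarith
  have hfm : ∀ x y : ℝ, 1 ≤ x → x ≤ y → f x ≤ f y := by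
    intro x y hx hxy
    have h := hratio x y hx hxy
    have hfy := hf_pos y (hx.trans hxy)
    have h1 : (x / y) ^ β ≤ 1 := Real.rpow_le_one (div_nonneg (by linarith) (by linarith))
      (div_le_one_of_le₀ hxy (by linarith)) hβ.le
    have := h.trans h1
    rwa [div_le_one hfy] at this
  have hFmono : Monotone F := fun x y hxy => hfm _ _ (hm1 x) (max_le_max le_rfl hxy)
  have hFtop : Tendsto F atTop atTop := by
    have h1 : Tendsto (fun x : ℝ => f 1 * x ^ β) atTop atTop :=
      (_root_.tendsto_rpow_atTop hβ).const_mul_atTop (hf_pos 1 le_rfl)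
    refine tendsto_atTop_mono' _ ?_ h1
    filter_upwards [eventually_ge_atTop 1] with x hx
    have h := hB 1 x le_rfl hx
    rw [Real.one_rpow, div_one, le_div_iff₀ (Real.rpow_pos_of_pos (by linarith) β)] at h
    simpa [hF, max_eq_right hx] using h
  have hFB : ∀ s t : ℝ, 1 ≤ s → s ≤ t → F s / F t ≤ (s / t) ^ β := by
    intro s t hs hst
    simp only [hF, max_eq_right hs, max_eq_right (hs.trans hst)]
    exact hratio s t hs hst
  have hean : Antitone e := fun x y hxy => hd_dec _ _ (hm1 x) (max_le_max le_rfl hxy)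
  have he0 : ∀ s, 0 < e s := fun s => hd_pos _ (hm1 s)
  have he1 : ∀ s, e s ≤ e 1 := fun s => by
    simp only [he, max_self]
    exact hd_dec _ _ le_rfl (hm1 s)
  have hcongr : ∀ (a S : ℝ), 1 ≤ a → a ≤ S → ∫ s in a..S, d s = ∫ s in a..S, e s := by
    intro a S ha hS
    refine intervalIntegral.integral_congr fun s hs => ?_
    rw [Set.uIcc_of_le hS] at hs
    simp [he, max_eq_right (ha.trans hs.1)]
  have heM := d_bound e hean he0 (by
    intro k hk
    have hk' : (1:ℝ) ≤ k := by exact_mod_cast hk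
    rw [← hcongr _ _ hk' (by linarith)]
    exact hd_sum k hk)
  have heD : Tendsto (fun S : ℝ => ∫ s in (1 : ℝ)..S, e s) atTop atTop := by
    refine hd_div.congr' ?_
    filter_upwards [eventually_ge_atTop 1] with S hS
    exact hcongr 1 S le_rfl hS
  set X : ℝ → Ω → ℝ := fun s ω => ((π (F s) ω : ℝ) - F s) / Real.sqrt (F s) with hXdef
  have hFmeas : Measurable F := hFmono.measurable
  have hX : Measurable (Function.uncurry X) := by
    have h1 : Measurable (fun q : ℝ × Ω => π (F q.1) q.2) :=
      hπjoint.comp (by fun_prop : Measurable fun q : ℝ × Ω => (F q.1, q.2))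
    have h2 : Measurable (fun q : ℝ × Ω => ((π (F q.1) q.2 : ℕ) : ℝ)) := measurable_from_nat.comp h1
    have h3 : Measurable (fun q : ℝ × Ω => F q.1) := hFmeas.comp measurable_fst
    exact (h2.sub h3).div h3.sqrt
  have hall : ∀ᵐ ω ∂P, ∀ (T : Finset (ℚ × ℚ)) (n : ℕ),
      Tendsto (fun S : ℝ => (1 / ∫ s in (1 : ℝ)..S, e s) * ∫ s in (1 : ℝ)..S,
        ((thickenedIndicator (δ := (1 : ℝ) / (n + 1)) (by positivity) (⋃ p ∈ T, Set.Ioo (p.1:ℝ) p.2)ᶜ (X s ω) : ℝ≥0) : ℝ) * e s) atTop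
      (𝓝 (∫ y, ((thickenedIndicator (δ := (1 : ℝ) / (n + 1)) (by positivity) (⋃ p ∈ T, Set.Ioo (p.1:ℝ) p.2)ᶜ y : ℝ≥0) : ℝ) ∂(gaussianReal 0 1))) := by
    rw [ae_all_iff]; intro T
    rw [ae_all_iff]; intro n
    have hlip := lipschitzWith_thickenedIndicator (δ := (1 : ℝ) / (n + 1)) (by positivity) (⋃ p ∈ T, Set.Ioo (p.1:ℝ) p.2)ᶜ
    refine one_fun P π hπmeas hπ0 hπindep hπdist X hX F (fun _ _ => rfl) hFpos hFmono hFtop β hβ hFB e hean he0 he1 _ heM heD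
      (fun y => ((thickenedIndicator (δ := (1 : ℝ) / (n + 1)) (by positivity) (⋃ p ∈ T, Set.Ioo (p.1:ℝ) p.2)ᶜ y : ℝ≥0) : ℝ))
      1 (((1 : ℝ) / (n + 1)).toNNReal⁻¹ : ℝ≥0) ?_ ?_ (NNReal.coe_nonneg _) (fun x y => ?_)
    · intro x
      rw [abs_of_nonneg (NNReal.coe_nonneg _)]
      exact_mod_cast thickenedIndicator_le_one _ _ _
    · exact NNReal.continuous_coe.comp hlip.continuous
    · have := hlip.dist_le_mul x y
      rw [NNReal.dist_eq, Real.dist_eq] at this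
      exact this
  filter_upwards [hall] with ω hω
  have hXω : Measurable fun s => X s ω := hX.comp (by fun_prop : Measurable fun s : ℝ => (s, ω))
  have hex : ∀ S : ℝ, ∃ μ : ProbabilityMeasure ℝ, 1 < S → ∀ h : ℝ → ℝ, Continuous h → ∫ x, h x ∂(μ : Measure ℝ) =
      (1 / ∫ s in (1 : ℝ)..S, e s) * ∫ s in (1 : ℝ)..S, h (X s ω) * e s := by
    intro S
    by_cases hS : 1 < S
    · obtain ⟨μ, hμ⟩ := avg_measure e hean he0 (fun s => X s ω) hXω S hS
      exact ⟨μ, fun _ => hμ⟩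
    · exact ⟨⟨gaussianReal 0 1, inferInstance⟩, fun h => absurd h hS⟩
  choose μs hμs using hex
  let m0 : ProbabilityMeasure ℝ := ⟨gaussianReal 0 1, inferInstance⟩
  have hconv : Tendsto μs atTop (𝓝 m0) := by
    refine lemC μs m0 fun T n => ?_
    refine (hω T n).congr' ?_
    filter_upwards [eventually_gt_atTop 1] with S hS
    refine (hμs S hS (fun y => ((thickenedIndicator (δ := (1 : ℝ) / (n + 1)) (by positivity) (⋃ p ∈ T, Set.Ioo (p.1:ℝ) p.2)ᶜ y : ℝ≥0) : ℝ)) ?_).symm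
    exact NNReal.continuous_coe.comp (lipschitzWith_thickenedIndicator (δ := (1 : ℝ) / (n + 1)) (by positivity) (⋃ p ∈ T, Set.Ioo (p.1:ℝ) p.2)ᶜ).continuous
  intro g
  refine ((ProbabilityMeasure.tendsto_iff_forall_integral_tendsto.1 hconv) g).congr' ?_
  filter_upwards [eventually_gt_atTop 1] with S hS
  rw [hμs S hS g g.continuous, hcongr 1 S le_rfl hS.le]
  congr 1
  refine intervalIntegral.integral_congr fun s hs => ?_
  rw [Set.uIcc_of_le hS.le] at hs
  simp [hXdef, hF, he, max_eq_right hs.1]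
end

section
/- Let ξ₁, …, ξₙ be independent integrable real random variables with E[ξᵢ] = 0 for each i, and let S_k = ξ₁ + ⋯ + ξ_k denote the partial sums. Then E[max_{1 ≤ k ≤ n} |S_k|] ≤ 4·E[|S_n|]. (Maximal-moment inequality for sums of independent centered random variables, used in the proof of display (11).) -/
open MeasureTheory ProbabilityTheory Filter Topology NNReal

/-- partial sums -/
noncomputable def pS {n : ℕ} (k : ℕ) (x : Fin n → ℝ) : ℝ := ∑ i : Fin n, if (i : ℕ) < k then x i else 0

lemma pS_meas {n : ℕ} (k : ℕ) : Measurable (pS (n := n) k) := by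
  unfold pS
  refine Finset.measurable_sum _ fun i _ => ?_
  split_ifs <;> fun_prop

lemma pS_eq {n : ℕ} (k : ℕ) (hk : k ≤ n) (f : ℕ → ℝ) :
    pS k (fun i : Fin n => f i) = ∑ i ∈ Finset.range k, f i := by
  unfold pS
  rw [Fin.sum_univ_eq_sum_range (fun i => if i < k then f i else 0) n, ← Finset.sum_filter]
  congr 1
  ext i
  simp only [Finset.mem_filter, Finset.mem_range]
  omega

/-- flip of the tail -/
noncomputable def flipT {n : ℕ} (k : ℕ) (x : Fin n → ℝ) : Fin n → ℝ :=
  fun i => (if (i : ℕ) < k then id else fun y => -y) (x i)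

lemma pS_flip_le {n : ℕ} (j k : ℕ) (hj : j ≤ k) (x : Fin n → ℝ) :
    pS j (flipT k x) = pS j x := by
  unfold pS flipT
  refine Finset.sum_congr rfl fun i _ => ?_
  by_cases h : (i : ℕ) < j
  · simp [h, h.trans_le hj]
  · simp [h]

lemma pS_flip_n {n : ℕ} (k : ℕ) (x : Fin n → ℝ) :
    pS n (flipT k x) = 2 * pS k x - pS n x := by
  unfold pS flipT
  rw [Finset.mul_sum, ← Finset.sum_sub_distrib]
  refine Finset.sum_congr rfl fun i _ => ?_
  by_cases h : (i : ℕ) < k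
  · simp [h]; ring
  · simp [h]

/-- first passage event -/
def fpA (n : ℕ) (t : ℝ) (k : ℕ) : Set (Fin n → ℝ) :=
  {x | t < |pS k x| ∧ ∀ j ∈ Finset.Icc 1 n, j < k → |pS j x| ≤ t}

lemma fpA_meas (n : ℕ) (t : ℝ) (k : ℕ) : MeasurableSet (fpA n t k) := by
  have h (j : ℕ) : Measurable fun x : Fin n → ℝ => |pS j x| := (pS_meas j).abs
  have : fpA n t k = {x | t < |pS k x|} ∩ ⋂ j ∈ Finset.Icc 1 n, ⋂ (_ : j < k), {x | |pS j x| ≤ t} := by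
    ext x; simp [fpA]
  rw [this]
  refine (measurableSet_lt measurable_const (h k)).inter ?_
  refine Finset.measurableSet_biInter _ fun j _ => MeasurableSet.iInter fun _ =>
    measurableSet_le (h j) measurable_const

lemma levy {n : ℕ} (μ : Fin n → Measure ℝ) [∀ i, IsProbabilityMeasure (μ i)]
    (hs : ∀ i, MeasurePreserving (fun y : ℝ => -y) (μ i) (μ i)) (t : ℝ) :
    Measure.pi μ {x | ∃ k ∈ Finset.Icc 1 n, t < |pS k x|} ≤
      2 * Measure.pi μ {x | t < |pS n x|} := by
  set Q := Measure.pi μ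
  set B : Set (Fin n → ℝ) := {x | t < |pS n x|}
  have hB : MeasurableSet B := measurableSet_lt measurable_const (pS_meas n).abs
  have hfl (k : ℕ) : MeasurePreserving (flipT k) Q Q := by
    refine measurePreserving_pi μ μ
      (f := fun i : Fin n => if (i : ℕ) < k then id else fun y => -y) fun i => ?_
    split_ifs
    · exact MeasurePreserving.id _
    · exact hs i
  have hk (k : ℕ) : Q (fpA n t k) ≤ 2 * Q (fpA n t k ∩ B) := by
    have hsub : fpA n t k ⊆ (fpA n t k ∩ B) ∪ flipT k ⁻¹' (fpA n t k ∩ B) := by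
      intro x hx
      by_cases hxB : x ∈ B
      · exact Or.inl ⟨hx, hxB⟩
      · right
        refine ⟨⟨?_, fun j hj hjk => ?_⟩, ?_⟩
        · rw [pS_flip_le _ _ le_rfl]; exact hx.1
        · rw [pS_flip_le _ _ hjk.le]; exact hx.2 j hj hjk
        · have h1 := hx.1
          simp only [B, Set.mem_ofPred_eq, not_lt] at hxB ⊢
          rw [pS_flip_n]
          have h3 : |2 * pS k x| ≤ |2 * pS k x - pS n x| + |pS n x| := by
            simpa using abs_add_le (2 * pS k x - pS n x) (pS n x)
          rw [abs_mul, abs_two] at h3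
          linarith
    calc Q (fpA n t k) ≤ _ := measure_mono hsub
      _ ≤ _ := measure_union_le _ _
      _ = _ := by
        rw [(hfl k).measure_preimage ((fpA_meas n t k).inter hB).nullMeasurableSet, two_mul]
  have hsub : {x : Fin n → ℝ | ∃ k ∈ Finset.Icc 1 n, t < |pS k x|} ⊆
      ⋃ k ∈ Finset.Icc 1 n, fpA n t k := by
    intro x hx
    classical
    have hx' : ∃ k, k ∈ Finset.Icc 1 n ∧ t < |pS k x| := hx
    have h := Nat.find_spec hx'
    simp only [Set.mem_iUnion]
    refine ⟨Nat.find hx', h.1, h.2, fun j hj hjk => ?_⟩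
    have := Nat.find_min hx' hjk
    push Not at this
    exact this hj
  calc _ ≤ _ := measure_mono hsub
    _ ≤ ∑ k ∈ Finset.Icc 1 n, Q (fpA n t k) := measure_biUnion_finset_le _ _
    _ ≤ ∑ k ∈ Finset.Icc 1 n, 2 * Q (fpA n t k ∩ B) := Finset.sum_le_sum fun k _ => hk k
    _ = 2 * Q (⋃ k ∈ Finset.Icc 1 n, fpA n t k ∩ B) := by
      rw [← Finset.mul_sum, measure_biUnion_finset]
      · intro i hi j hj hij
        refine Set.disjoint_left.mpr fun x hxi hxj => ?_
        rcases lt_or_gt_of_ne hij with h | h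
        · exact absurd (hxj.1.2 i hi h) (not_le.mpr hxi.1.1)
        · exact absurd (hxi.1.2 j hj h) (not_le.mpr hxj.1.1)
      · exact fun k _ => (fpA_meas n t k).inter hB
    _ ≤ 2 * Q B := by
      gcongr
      simp

lemma sup_meas {α : Type*} [MeasurableSpace α] {s : Finset ℕ} (hs : s.Nonempty) (f : ℕ → α → ℝ)
    (hf : ∀ k, Measurable (f k)) : Measurable fun x => s.sup' hs (fun k => f k x) := by
  have := Finset.measurable_sup' hs (f := f) fun k _ => hf k
  convert this using 1
  ext x
  simp

lemma levy_lint {n : ℕ} (hn : 1 ≤ n) (μ : Fin n → Measure ℝ) [∀ i, IsProbabilityMeasure (μ i)]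
    (hs : ∀ i, MeasurePreserving (fun y : ℝ => -y) (μ i) (μ i)) :
    ∫⁻ x, ENNReal.ofReal ((Finset.Icc 1 n).sup' (Finset.nonempty_Icc.mpr hn)
        (fun k => |pS k x|)) ∂(Measure.pi μ) ≤
      2 * ∫⁻ x, ENNReal.ofReal |pS n x| ∂(Measure.pi μ) := by
  rw [lintegral_eq_lintegral_meas_lt, lintegral_eq_lintegral_meas_lt,
    ← lintegral_const_mul' _ _ (by simp)]
  · refine lintegral_mono fun t => ?_
    convert levy μ hs t using 3
    ext x
    simp [Finset.lt_sup'_iff]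
  · exact ae_of_all _ fun x => abs_nonneg _
  · exact (pS_meas n).abs.aemeasurable
  · refine ae_of_all _ fun x => ?_
    exact (abs_nonneg (pS n x)).trans
      (Finset.le_sup' (fun k => |pS k x|) (Finset.mem_Icc.mpr ⟨hn, le_rfl⟩))
  · exact (sup_meas _ _ fun k => (pS_meas k).abs).aemeasurable

lemma symm_law {Ω : Type*} [MeasurableSpace Ω] (P : Measure Ω) [IsProbabilityMeasure P]
    (n : ℕ) (ξ : ℕ → Ω → ℝ) (hmeas : ∀ i, Measurable (ξ i))
    (hindep : iIndepFun (fun i : Fin n => ξ i) P) :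
    (P.prod P).map (fun p (i : Fin n) => ξ i p.1 - ξ i p.2) =
      Measure.pi fun i : Fin n => ((P.map (ξ i)).prod (P.map (ξ i))).map fun q => q.1 - q.2 := by
  have hp (i : ℕ) : IsProbabilityMeasure (P.map (ξ i)) :=
    Measure.isProbabilityMeasure_map (hmeas i).aemeasurable
  have h1 := (iIndepFun_iff_map_fun_eq_pi_map (f := fun i : Fin n => ξ i)
    (fun i => (hmeas i).aemeasurable)).mp hindep
  have hv : Measurable fun ω (i : Fin n) => ξ i ω := measurable_pi_lambda _ fun i => hmeas i
  have hd : Measurable fun q : ℝ × ℝ => q.1 - q.2 := by fun_prop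
  have hpr (i : Fin n) : IsProbabilityMeasure
      (((P.map (ξ i)).prod (P.map (ξ i))).map fun q => q.1 - q.2) :=
    Measure.isProbabilityMeasure_map hd.aemeasurable
  have h2 := (measurePreserving_arrowProdEquivProdArrow ℝ ℝ (Fin n) (fun i => P.map (ξ i))
    (fun i => P.map (ξ i))).symm
  rw [← Measure.pi_map_pi (fun i => hd.aemeasurable), ← h2.map_eq, ← h1,
    Measure.map_prod_map _ _ hv hv, Measure.map_map, Measure.map_map]
  · rfl
  · exact (measurable_pi_lambda _ fun i => hd.comp (measurable_pi_apply i)).comp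
      (MeasurableEquiv.measurable _)
  · exact hv.prodMap hv
  · exact (measurable_pi_lambda _ fun i => hd.comp (measurable_pi_apply i))
  · exact MeasurableEquiv.measurable _

lemma symm_neg (μ : Measure ℝ) [IsProbabilityMeasure μ] :
    MeasurePreserving (fun y : ℝ => -y) ((μ.prod μ).map fun q => q.1 - q.2)
      ((μ.prod μ).map fun q => q.1 - q.2) := by
  have hd : Measurable fun q : ℝ × ℝ => q.1 - q.2 := by fun_prop
  refine ⟨measurable_neg, ?_⟩
  conv_rhs => rw [← Measure.prod_swap (μ := μ) (ν := μ)]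
  rw [Measure.map_map measurable_neg hd, Measure.map_map hd measurable_swap]
  congr 1
  ext q
  simp

lemma main_lint {Ω : Type*} [MeasurableSpace Ω] (P : Measure Ω) [IsProbabilityMeasure P]
    (n : ℕ) (hn : 1 ≤ n)
    (ξ : ℕ → Ω → ℝ)
    (hmeas : ∀ i, Measurable (ξ i))
    (hindep : iIndepFun (fun i : Fin n => ξ i) P)
    (hint : ∀ i < n, Integrable (ξ i) P)
    (hcent : ∀ i < n, ∫ ω, ξ i ω ∂P = 0) :
    ∫⁻ ω, ENNReal.ofReal ((Finset.Icc 1 n).sup' (Finset.nonempty_Icc.mpr hn)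
        (fun k => |∑ i ∈ Finset.range k, ξ i ω|)) ∂P
      ≤ 4 * ∫⁻ ω, ENNReal.ofReal |∑ i ∈ Finset.range n, ξ i ω| ∂P := by
  set S : ℕ → Ω → ℝ := fun k ω => ∑ i ∈ Finset.range k, ξ i ω with hS
  have hSm (k : ℕ) : Measurable (S k) := Finset.measurable_sum _ fun i _ => hmeas i
  have hSi (k : ℕ) (hk : k ≤ n) : Integrable (S k) P :=
    integrable_finsetSum _ fun i hi => hint i ((Finset.mem_range.mp hi).trans_le hk)
  have hS0 (k : ℕ) (hk : k ≤ n) : ∫ ω, S k ω ∂P = 0 := by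
    rw [hS, integral_finsetSum _ fun i hi => hint i ((Finset.mem_range.mp hi).trans_le hk)]
    exact Finset.sum_eq_zero fun i hi => hcent i ((Finset.mem_range.mp hi).trans_le hk)
  have hne := Finset.nonempty_Icc.mpr hn
  set F : Ω × Ω → Fin n → ℝ := fun p i => ξ i p.1 - ξ i p.2 with hF
  have hFm : Measurable F := measurable_pi_lambda _ fun i =>
    ((hmeas i).comp measurable_fst).sub ((hmeas i).comp measurable_snd)
  have hFS (k : ℕ) (hk : k ≤ n) (p : Ω × Ω) : pS k (F p) = S k p.1 - S k p.2 := by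
    rw [hF]
    simp only
    rw [pS_eq k hk (fun i => ξ i p.1 - ξ i p.2), Finset.sum_sub_distrib]
  set M : (Fin n → ℝ) → ℝ := fun x => (Finset.Icc 1 n).sup' hne (fun k => |pS k x|) with hM
  have hMm : Measurable M := sup_meas _ _ fun k => (pS_meas k).abs
  have hp (i : ℕ) : IsProbabilityMeasure (P.map (ξ i)) :=
    Measure.isProbabilityMeasure_map (hmeas i).aemeasurable
  have hpr (i : Fin n) : IsProbabilityMeasure
      (((P.map (ξ i)).prod (P.map (ξ i))).map fun q => q.1 - q.2) :=
    Measure.isProbabilityMeasure_map (by fun_prop)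
  have hlaw := symm_law P n ξ hmeas hindep
  have hlevy := levy_lint hn _ (fun i : Fin n => symm_neg (P.map (ξ i)))
  rw [← hlaw, lintegral_map hMm.ennreal_ofReal hFm,
    lintegral_map (pS_meas n).abs.ennreal_ofReal hFm] at hlevy
  calc ∫⁻ ω, ENNReal.ofReal ((Finset.Icc 1 n).sup' hne (fun k => |S k ω|)) ∂P
      ≤ ∫⁻ ω, ∫⁻ ω', ENNReal.ofReal (M (F (ω, ω'))) ∂P ∂P := by
        refine lintegral_mono fun ω => ?_
        obtain ⟨k, hk, hk'⟩ := Finset.exists_mem_eq_sup' hne (fun k => |S k ω|)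
        rw [hk']
        have hkn := (Finset.mem_Icc.mp hk).2
        have e : S k ω = ∫ ω', (S k ω - S k ω') ∂P := by
          rw [integral_sub (integrable_const _) (hSi k hkn), hS0 k hkn]; simp
        calc ENNReal.ofReal |S k ω| = ‖∫ ω', (S k ω - S k ω') ∂P‖ₑ := by
              rw [← e, Real.enorm_eq_ofReal_abs]
          _ ≤ _ := enorm_integral_le_lintegral_enorm _
          _ ≤ _ := by
            refine lintegral_mono fun ω' => ?_
            rw [Real.enorm_eq_ofReal_abs, ← hFS k hkn (ω, ω')]
            exact ENNReal.ofReal_le_ofReal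
              (Finset.le_sup' (fun k => |pS k (F (ω, ω'))|) hk)
    _ = ∫⁻ p, ENNReal.ofReal (M (F p)) ∂(P.prod P) :=
        (lintegral_prod _ (hMm.comp hFm).ennreal_ofReal.aemeasurable).symm
    _ ≤ 2 * ∫⁻ p, ENNReal.ofReal |pS n (F p)| ∂(P.prod P) := hlevy
    _ ≤ 2 * ∫⁻ p, (ENNReal.ofReal |S n p.1| + ENNReal.ofReal |S n p.2|) ∂(P.prod P) := by
        gcongr with p
        rw [hFS n le_rfl, ← ENNReal.ofReal_add (abs_nonneg _) (abs_nonneg _)]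
        exact ENNReal.ofReal_le_ofReal (abs_sub _ _)
    _ = 4 * ∫⁻ ω, ENNReal.ofReal |S n ω| ∂P := by
        have hm : Measurable fun ω => ENNReal.ofReal |S n ω| := (hSm n).abs.ennreal_ofReal
        have h1 : Measurable fun p : Ω × Ω => ENNReal.ofReal |S n p.1| := hm.comp measurable_fst
        have h2 : Measurable fun p : Ω × Ω => ENNReal.ofReal |S n p.2| := hm.comp measurable_snd
        rw [lintegral_add_left h1, lintegral_prod _ h1.aemeasurable,
          lintegral_prod _ h2.aemeasurable]
        simp only [lintegral_const, measure_univ, mul_one]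
        rw [← two_mul, ← mul_assoc]
        norm_num


/-- **Maximal-moment inequality for sums of independent centered random variables**
(used in the proof of display (11)): if `ξ₁, …, ξₙ` are independent, integrable and
centered, and `S_k = ξ₁ + ⋯ + ξ_k`, then `E[max_{1 ≤ k ≤ n} |S_k|] ≤ 4 E[|S_n|]`. -/
theorem stmt14
    {Ω : Type*} [MeasurableSpace Ω] (P : Measure Ω) [IsProbabilityMeasure P]
    (n : ℕ) (hn : 1 ≤ n)
    (ξ : ℕ → Ω → ℝ)
    (hmeas : ∀ i, Measurable (ξ i))
    (hindep : iIndepFun (fun i : Fin n => ξ i) P)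
    (hint : ∀ i < n, Integrable (ξ i) P)
    (hcent : ∀ i < n, ∫ ω, ξ i ω ∂P = 0) :
    ∫ ω, (Finset.Icc 1 n).sup' (Finset.nonempty_Icc.mpr hn)
        (fun k => |∑ i ∈ Finset.range k, ξ i ω|) ∂P
      ≤ 4 * ∫ ω, |∑ i ∈ Finset.range n, ξ i ω| ∂P := by
  have hm (k : ℕ) : Measurable fun ω => |∑ i ∈ Finset.range k, ξ i ω| :=
    (Finset.measurable_sum _ fun i _ => hmeas i).abs
  have hi : Integrable (fun ω => |∑ i ∈ Finset.range n, ξ i ω|) P :=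
    (integrable_finsetSum _ fun i hi => hint i (Finset.mem_range.mp hi)).abs
  rw [integral_eq_lintegral_of_nonneg_ae, integral_eq_lintegral_of_nonneg_ae]
  · have h := main_lint P n hn ξ hmeas hindep hint hcent
    have h2 := ENNReal.toReal_mono (ENNReal.mul_ne_top (by simp)
      (hi.lintegral_lt_top).ne) h
    simpa [ENNReal.toReal_mul] using h2
  · exact ae_of_all _ fun x => abs_nonneg _
  · exact (hm n).aestronglyMeasurable
  · refine ae_of_all _ fun ω => ?_
    exact (abs_nonneg _).trans
      (Finset.le_sup' (fun k => |∑ i ∈ Finset.range k, ξ i ω|) (Finset.mem_Icc.mpr ⟨hn, le_rfl⟩))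
  · exact (sup_meas _ _ hm).aestronglyMeasurable
end
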